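/- There exists a constant C > 0 such that for every integer n ≥ 1, ∫_{ℙ¹} |log|F_n(λ)| − d^{n−1}·g_I(λ)| dω(λ) ≤ ((2 log d)/(d−1))·n + C. -/

import Mathlib

open MeasureTheory Real

noncomputable def fc (d : ℕ) (lam z : ℂ) : ℂ := z ^ d + lam


lemma cdet (c : ℂ) : |((ContinuousLinearMap.toSpanSingleton ℂ c).restrictScalars ℝ : ℂ →L[ℝ] ℂ).det| = ‖c‖^2 := by
  rw [ContinuousLinearMap.det]
  have : ((((ContinuousLinearMap.toSpanSingleton ℂ c).restrictScalars ℝ : ℂ →L[ℝ] ℂ)) : ℂ →ₗ[ℝ] ℂ)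
    = ((ContinuousLinearMap.toSpanSingleton ℂ c : ℂ →L[ℂ] ℂ) : ℂ →ₗ[ℂ] ℂ).restrictScalars ℝ := rfl
  rw [this, LinearMap.det_restrictScalars]
  simp [Algebra.norm_complex_apply, Complex.normSq_eq_norm_sq]

lemma cv {s : Set ℂ} (hs : MeasurableSet s) {F F' : ℂ → ℂ}
    (h : ∀ x ∈ s, HasDerivAt F (F' x) x) (inj : Set.InjOn F s) (g : ℂ → ENNReal) :
    ∫⁻ x in F '' s, g x = ∫⁻ x in s, ‖F' x‖ₑ ^ 2 * g (F x) := by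
  rw [lintegral_image_eq_lintegral_abs_det_fderiv_mul volume hs
    (f' := fun x => (ContinuousLinearMap.toSpanSingleton ℂ (F' x)).restrictScalars ℝ)
    (fun x hx => ((h x hx).hasFDerivAt.restrictScalars ℝ).hasFDerivWithinAt) inj]
  refine lintegral_congr fun x => ?_
  rw [cdet, ENNReal.ofReal_pow (norm_nonneg _), ofReal_norm]

lemma cv_meas {s : Set ℂ} (hs : MeasurableSet s) {F F' : ℂ → ℂ}
    (h : ∀ x ∈ s, HasDerivAt F (F' x) x) (inj : Set.InjOn F s) : MeasurableSet (F '' s) :=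
  measurable_image_of_fderivWithin hs
    (f' := fun x => (ContinuousLinearMap.toSpanSingleton ℂ (F' x)).restrictScalars ℝ)
    (fun x hx => ((h x hx).hasFDerivAt.restrictScalars ℝ).hasFDerivWithinAt) inj

lemma circ_bound (k : ℂ → ℂ) {r : ℝ} (hr : 0 < r) :
    ‖∮ z in C(0, r), k z‖ₑ ≤ ENNReal.ofReal r *
      ∫⁻ θ in Set.Ioo (-π) π, ‖k (Complex.polarCoord.symm (r, θ))‖ₑ := by
  have hper : Function.Periodic (fun θ : ℝ => deriv (circleMap 0 r) θ • k (circleMap 0 r θ)) (2*π) := by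
    intro θ
    simp only [deriv_circleMap, periodic_circleMap 0 r θ]
  have h1 : (∮ z in C(0, r), k z) = ∫ θ in (-π)..π, deriv (circleMap 0 r) θ • k (circleMap 0 r θ) := by
    have := hper.intervalIntegral_add_eq 0 (-π)
    rw [circleIntegral]
    rw [zero_add] at this
    rw [this]; congr 1; ring
  rw [h1, intervalIntegral.integral_of_le (by linarith [pi_pos]),
    integral_Ioc_eq_integral_Ioo]
  refine (enorm_integral_le_lintegral_enorm _).trans ?_
  rw [← lintegral_const_mul' _ _ (by simp)]
  refine lintegral_mono fun θ => ?_
  have e : circleMap 0 r θ = Complex.polarCoord.symm (r, θ) := by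
    simp [circleMap, Complex.exp_mul_I]
  rw [e, deriv_circleMap, e]
  simp only [smul_eq_mul, enorm_mul]
  gcongr
  rw [← ofReal_norm, ← ofReal_norm, ← ENNReal.ofReal_mul (norm_nonneg _)]
  apply ENNReal.ofReal_le_ofReal
  rw [Complex.norm_polarCoord_symm]; simp [abs_of_pos hr]

lemma polar_lower (k : ℂ → ℂ) (hk : Measurable k) {a b : ℝ} (ha : 0 ≤ a) :
    ∫⁻ r in Set.Ioo a b, ‖∮ z in C(0, r), k z‖ₑ ≤ ∫⁻ z in {z : ℂ | a < ‖z‖ ∧ ‖z‖ < b}, ‖k z‖ₑ := by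
  have hm : MeasurableSet {z : ℂ | a < ‖z‖ ∧ ‖z‖ < b} := by measurability
  rw [← lintegral_indicator hm, ← Complex.lintegral_comp_polarCoord_symm,
    polarCoord_target, Measure.volume_eq_prod, ← Measure.prod_restrict]
  have hpm : Measurable (fun p : ℝ × ℝ => Complex.polarCoord.symm p) := by
    simp only [Complex.polarCoord_symm_apply]; fun_prop
  rw [lintegral_prod]
  · have hsub : Set.Ioo a b ⊆ Set.Ioi 0 := fun x hx => lt_of_le_of_lt ha hx.1
    refine le_trans ?_ (lintegral_mono_set hsub)
    refine setLIntegral_mono' measurableSet_Ioo fun r hr => ?_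
    have hr0 : 0 < r := hsub hr
    refine (circ_bound k hr0).trans ?_
    rw [← lintegral_const_mul' _ _ (by simp)]
    refine lintegral_mono fun θ => ?_
    rw [Set.indicator_of_mem]
    · rfl
    · simp only [Set.mem_ofPred_eq, Complex.norm_polarCoord_symm, abs_of_pos hr0]; exact hr
  · apply Measurable.aemeasurable
    simp only [smul_eq_mul]
    exact (ENNReal.measurable_ofReal.comp measurable_fst).mul
      ((hk.enorm.indicator hm).comp hpm)

lemma radial (f : ℝ → ENNReal) (hf : Measurable f) :
    ∫⁻ z : ℂ, f ‖z‖ = ENNReal.ofReal (2*π) * ∫⁻ r in Set.Ioi (0:ℝ), ENNReal.ofReal r * f r := by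
  rw [← Complex.lintegral_comp_polarCoord_symm,
    polarCoord_target, Measure.volume_eq_prod, ← Measure.prod_restrict]
  simp only [Complex.norm_polarCoord_symm, smul_eq_mul]
  rw [lintegral_prod]
  · rw [← lintegral_const_mul' _ _ ENNReal.ofReal_ne_top]
    refine setLIntegral_congr_fun measurableSet_Ioi fun r hr => ?_
    simp only [lintegral_const, Measure.restrict_apply MeasurableSet.univ, Set.univ_inter, Real.volume_Ioo, abs_of_pos (show 0 < r from hr)]
    rw [mul_comm]; congr 2; ring
  · apply Measurable.aemeasurable
    fun_prop

lemma radial_on (f : ℝ → ENNReal) (hf : Measurable f) {t : Set ℝ} (ht : MeasurableSet t) :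
    ∫⁻ z in {z : ℂ | ‖z‖ ∈ t}, f ‖z‖ =
      ENNReal.ofReal (2*π) * ∫⁻ r in t ∩ Set.Ioi (0:ℝ), ENNReal.ofReal r * f r := by
  have hm : MeasurableSet {z : ℂ | ‖z‖ ∈ t} := measurable_norm ht
  rw [← lintegral_indicator hm]
  have := radial (t.indicator f) (hf.indicator ht)
  have e : (fun z : ℂ => t.indicator f ‖z‖) = Set.indicator {z : ℂ | ‖z‖ ∈ t} (fun z => f ‖z‖) := by
    ext z; simp [Set.indicator]
  rw [e] at this
  rw [this, ← lintegral_indicator measurableSet_Ioi, ← lintegral_indicator (ht.inter measurableSet_Ioi)]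
  congr 2
  ext r
  by_cases h1 : r ∈ t <;> by_cases h2 : 0 < r <;> simp [Set.indicator, h1, h2]

lemma mean_area {g : ℂ → ℂ} {w : ℂ} {δ : ℝ} (hδ : 0 < δ)
    (hg : DifferentiableOn ℂ g (Metric.ball w δ)) (gm : Measurable g) :
    ENNReal.ofReal (π * δ^2) * ‖g w‖ₑ ≤ ∫⁻ z in Metric.ball w δ, ‖g z‖ₑ := by
  have h1 : ∫⁻ z in Metric.ball w δ, ‖g z‖ₑ = ∫⁻ z in Metric.ball 0 δ, ‖g (w + z)‖ₑ := by
    rw [← lintegral_indicator Metric.isOpen_ball.measurableSet,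
      ← lintegral_indicator Metric.isOpen_ball.measurableSet,
      ← lintegral_add_left_eq_self _ w]
    congr 1; ext z
    simp [Set.indicator]
  have h2 := polar_lower (fun z => g (w + z) * (‖z‖ / z)) (by fun_prop) (le_refl (0:ℝ)) (b := δ)
  have h3 : ∫⁻ z in {z : ℂ | 0 < ‖z‖ ∧ ‖z‖ < δ}, ‖g (w + z) * (‖z‖ / z)‖ₑ ≤ ∫⁻ z in Metric.ball 0 δ, ‖g (w + z)‖ₑ := by
    refine le_trans (lintegral_mono_set (t := Metric.ball 0 δ) ?_) ?_
    · intro z hz; simpa using hz.2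
    · refine lintegral_mono fun z => ?_
      rw [enorm_mul]
      refine mul_le_of_le_one_right' ?_
      rw [← ofReal_norm, ENNReal.ofReal_le_one]
      simp only [norm_div, Complex.norm_real, norm_norm]
      exact div_self_le_one _
  rw [h1]
  refine le_trans (le_of_eq ?_) (h2.trans h3)
  have h4 : ∀ r ∈ Set.Ioo 0 δ, ‖∮ z in C(0, r), g (w + z) * (‖z‖ / z)‖ₑ = ENNReal.ofReal (2 * π * r) * ‖g w‖ₑ := by
    intro r hr
    have e1 : (∮ z in C(0, r), g (w + z) * (‖z‖ / z)) = ∮ z in C(0, r), (r:ℂ) • ((z - 0)⁻¹ • g (w + z)) := by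
      refine circleIntegral.integral_congr hr.1.le fun z hz => ?_
      simp only [mem_sphere_iff_norm, sub_zero] at hz
      simp [hz]; ring
    have hd : DifferentiableOn ℂ (fun z => g (w + z)) (Metric.closedBall 0 r) := by
      refine hg.comp (by fun_prop) ?_
      intro z hz
      simp at hz ⊢
      exact hz.trans_lt hr.2
    have e2 := (hd.diffContOnCl_ball (subset_refl _)).circleIntegral_sub_inv_smul (w := 0) (by simpa using hr.1)
    rw [e1, circleIntegral.integral_smul, e2]
    rw [← ofReal_norm, ← ofReal_norm, ← ENNReal.ofReal_mul (by have := pi_pos; have := hr.1; positivity)]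
    congr 1
    simp [abs_of_pos hr.1, abs_of_pos pi_pos]; ring
  rw [setLIntegral_congr_fun measurableSet_Ioo h4, lintegral_mul_const' _ _ (by simp)]
  congr 1
  rw [← ofReal_integral_eq_lintegral_ofReal]
  · rw [← integral_Ioc_eq_integral_Ioo, ← intervalIntegral.integral_of_le hδ.le]
    rw [intervalIntegral.integral_const_mul, integral_id]; congr 1; ring
  · exact (Continuous.integrableOn_Icc (a := 0) (b := δ) (by fun_prop)).mono_set Set.Ioo_subset_Icc_self
  · refine (ae_restrict_iff' measurableSet_Ioo).2 (.of_forall fun r hr => ?_)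
    have := pi_pos; have := hr.1; show (0:ℝ) ≤ 2*π*r; positivity

lemma int_inv_norm {ρ : ℝ} (hρ : 0 < ρ) :
    ∫⁻ z in Metric.ball (0:ℂ) ρ, ENNReal.ofReal (‖z‖⁻¹) = ENNReal.ofReal (2 * π * ρ) := by
  have := radial_on (fun r => ENNReal.ofReal (r⁻¹)) (by fun_prop) (t := Set.Iio ρ) measurableSet_Iio
  have e : {z : ℂ | ‖z‖ ∈ Set.Iio ρ} = Metric.ball (0:ℂ) ρ := by ext; simp
  rw [e] at this
  rw [this]
  have h : ∫⁻ r in Set.Iio ρ ∩ Set.Ioi (0:ℝ), ENNReal.ofReal r * ENNReal.ofReal (r⁻¹) = ∫⁻ r in Set.Iio ρ ∩ Set.Ioi (0:ℝ), 1 := by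
    refine setLIntegral_congr_fun (by measurability) fun r hr => ?_
    have h0 : 0 < r := hr.2
    rw [← ENNReal.ofReal_mul h0.le, mul_inv_cancel₀ h0.ne']; simp
  rw [h, Set.Iio_inter_Ioi]
  rw [setLIntegral_one, Real.volume_Ioo, sub_zero, ← ENNReal.ofReal_mul' hρ.le]

lemma hol_weight {g : ℂ → ℂ} {η : ℝ} (hη : 0 < η)
    (hg : DifferentiableOn ℂ g (Metric.ball 0 η)) (gm : Measurable g) :
    ∫⁻ z in Metric.ball 0 η, ‖g z‖ₑ * ENNReal.ofReal (η / ‖z‖) ≤ 6 * ∫⁻ z in Metric.ball 0 η, ‖g z‖ₑ := by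
  set I := ∫⁻ z in Metric.ball 0 η, ‖g z‖ₑ with hI
  have hsup : ∀ w ∈ Metric.ball (0:ℂ) (η/2), ‖g w‖ₑ ≤ ENNReal.ofReal (4 / (π * η^2)) * I := by
    intro w hw
    have hsub : Metric.ball w (η/2) ⊆ Metric.ball 0 η := by
      apply Metric.ball_subset_ball'
      simp at hw ⊢; linarith
    have := (mean_area (half_pos hη) (hg.mono hsub) gm).trans (lintegral_mono_set hsub)
    have hp : 0 < π * (η/2)^2 := by positivity
    calc ‖g w‖ₑ = ENNReal.ofReal (4 / (π * η^2)) * (ENNReal.ofReal (π * (η/2)^2) * ‖g w‖ₑ) := by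
          rw [← mul_assoc, ← ENNReal.ofReal_mul (by positivity)]
          rw [show 4 / (π * η^2) * (π * (η/2)^2) = 1 by field_simp; ring]
          simp
      _ ≤ _ := by gcongr
  have hsplit : Metric.ball (0:ℂ) η ⊆ Metric.ball 0 (η/2) ∪ (Metric.ball 0 η \ Metric.ball 0 (η/2)) := by
    intro z hz
    by_cases h : z ∈ Metric.ball (0:ℂ) (η/2)
    · exact Or.inl h
    · exact Or.inr ⟨hz, h⟩
  refine (lintegral_mono_set hsplit).trans ((lintegral_union_le _ _ _).trans ?_)
  have h1 : ∫⁻ z in Metric.ball 0 (η/2), ‖g z‖ₑ * ENNReal.ofReal (η / ‖z‖) ≤ 4 * I := by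
    calc _ ≤ ∫⁻ z in Metric.ball (0:ℂ) (η/2), (ENNReal.ofReal (4 / (π * η^2)) * I * ENNReal.ofReal η) * ENNReal.ofReal (‖z‖⁻¹) := by
          refine setLIntegral_mono' Metric.isOpen_ball.measurableSet fun z hz => ?_
          rw [div_eq_mul_inv, ENNReal.ofReal_mul hη.le, ← mul_assoc]
          gcongr
          exact hsup z hz
      _ = (ENNReal.ofReal (4 / (π * η^2)) * I * ENNReal.ofReal η) * ENNReal.ofReal (2 * π * (η/2)) := by
          rw [lintegral_const_mul _ (by fun_prop), int_inv_norm (half_pos hη)]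
      _ = (ENNReal.ofReal (4 / (π * η^2)) * ENNReal.ofReal η * ENNReal.ofReal (2 * π * (η/2))) * I := by ring
      _ = 4 * I := by
          rw [← ENNReal.ofReal_mul (by positivity), ← ENNReal.ofReal_mul (by positivity)]
          rw [show 4 / (π * η^2) * η * (2 * π * (η/2)) = 4 by field_simp]
          simp
  have h2 : ∫⁻ z in Metric.ball 0 η \ Metric.ball 0 (η/2), ‖g z‖ₑ * ENNReal.ofReal (η / ‖z‖) ≤ 2 * I := by
    calc _ ≤ ∫⁻ z in Metric.ball (0:ℂ) η \ Metric.ball 0 (η/2), 2 * ‖g z‖ₑ := by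
          refine setLIntegral_mono' (Metric.isOpen_ball.measurableSet.diff Metric.isOpen_ball.measurableSet) fun z hz => ?_
          rw [mul_comm]
          gcongr
          have : η/2 ≤ ‖z‖ := by simpa using hz.2
          rw [← ENNReal.ofReal_ofNat]
          apply ENNReal.ofReal_le_ofReal
          rw [div_le_iff₀ (by linarith)]; linarith
      _ ≤ 2 * I := by
          rw [lintegral_const_mul' _ _ (by simp)]
          gcongr
          exact lintegral_mono_set Set.sdiff_subset
  calc _ ≤ 4 * I + 2 * I := add_le_add h1 h2
    _ = 6 * I := by ring


lemma section_weight {p : Polynomial ℂ} {η : ℝ} (hη : 0 < η) {ψ : ℂ → ℂ}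
    (hc : ContinuousOn ψ (Metric.ball 0 η)) (hp : ∀ z ∈ Metric.ball (0:ℂ) η, p.eval (ψ z) = z)
    (hd : ∀ z ∈ Metric.ball (0:ℂ) η, p.derivative.eval (ψ z) ≠ 0) :
    MeasurableSet (ψ '' Metric.ball 0 η) ∧
    ∫⁻ x in ψ '' Metric.ball 0 η, ENNReal.ofReal (η / ‖p.eval x‖) ≤ 6 * volume (ψ '' Metric.ball 0 η) := by
  have hder : ∀ z ∈ Metric.ball (0:ℂ) η, HasDerivAt ψ (p.derivative.eval (ψ z))⁻¹ z := by
    intro z hz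
    have hn := Metric.isOpen_ball.mem_nhds hz
    refine HasDerivAt.of_local_left_inverse (hc.continuousAt hn) (p.hasDerivAt _) (hd z hz) ?_
    filter_upwards [hn] with y hy using hp y hy
  have hdiff : DifferentiableOn ℂ ψ (Metric.ball 0 η) := fun z hz => (hder z hz).differentiableAt.differentiableWithinAt
  have hder' : ∀ z ∈ Metric.ball (0:ℂ) η, HasDerivAt ψ (deriv ψ z) z := fun z hz => (hder z hz).differentiableAt.hasDerivAt
  have inj : Set.InjOn ψ (Metric.ball 0 η) := by
    intro a ha b hb h
    rw [← hp a ha, ← hp b hb, h]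
  refine ⟨cv_meas Metric.isOpen_ball.measurableSet hder' inj, ?_⟩
  rw [cv Metric.isOpen_ball.measurableSet hder' inj, ← setLIntegral_one (ψ '' Metric.ball 0 η), cv Metric.isOpen_ball.measurableSet hder' inj]
  have := hol_weight (g := fun z => (deriv ψ z)^2) hη ((hdiff.deriv Metric.isOpen_ball).pow 2) ((measurable_deriv ψ).pow_const 2)
  simp only [enorm_pow] at this
  simp only [mul_one]
  refine le_trans (le_of_eq ?_) this
  refine setLIntegral_congr_fun Metric.isOpen_ball.measurableSet fun z hz => ?_
  simp only [hp z hz]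

lemma covering_weight {p : Polynomial ℂ} {η : ℝ} (hη : 0 < η) {V W : Set ℂ} (hV : IsCompact V)
    (hW : W = V ∩ {x | ‖p.eval x‖ < η}) (hWo : IsOpen W)
    (hd : ∀ z ∈ W, p.derivative.eval z ≠ 0) :
    ∫⁻ x in W, ENNReal.ofReal (η / ‖p.eval x‖) ≤ 6 * volume W := by
  rcases Set.eq_empty_or_nonempty W with h0 | ⟨x0, hx0⟩
  · simp [h0]
  have hp0 : ∀ b : ℂ, p ≠ Polynomial.C b := by
    rintro b rfl
    exact hd x0 hx0 (by simp)
  have hWB : ∀ x : W, p.eval x.1 ∈ Metric.ball (0:ℂ) η := by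
    rintro ⟨x, hx⟩
    rw [hW] at hx
    simpa using hx.2
  let f : W → Metric.ball (0:ℂ) η := fun x => ⟨p.eval x.1, hWB x⟩
  have hfc : Continuous f := by
    refine Continuous.subtype_mk (p.continuous.comp continuous_subtype_val) _
  have hproper : IsProperMap f := by
    rw [isProperMap_iff_isCompact_preimage]
    refine ⟨hfc, fun K hK => ?_⟩
    rw [Subtype.isCompact_iff]
    have hK' := hK.image continuous_subtype_val
    have : Subtype.val '' (f ⁻¹' K) = V ∩ p.eval ⁻¹' (Subtype.val '' K) := by
      ext x
      constructor
      · rintro ⟨x, hx, rfl⟩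
        refine ⟨?_, ⟨f x, hx, rfl⟩⟩
        exact (hW.subset x.2).1
      · rintro ⟨hx, y, hy, hyx⟩
        have hxW : x ∈ W := by
          rw [hW]; refine ⟨hx, ?_⟩
          have := y.2
          rw [hyx] at this
          simpa using this
        refine ⟨⟨x, hxW⟩, ?_, rfl⟩
        have : f ⟨x, hxW⟩ = y := Subtype.ext hyx.symm
        simpa [this] using hy
    rw [this]
    exact hV.inter_right (hK'.isClosed.preimage p.continuous)
  have hfin : ∀ b : Metric.ball (0:ℂ) η, (f ⁻¹' {b}).Finite := by
    intro b
    have h1 : (p.eval ⁻¹' {b.1}).Finite := by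
      simpa only [Polynomial.preimage_eval_singleton (hp0 b.1)] using Polynomial.rootSet_finite ..
    refine Set.Finite.of_finite_image (f := Subtype.val) (h1.subset ?_) Subtype.val_injective.injOn
    rintro _ ⟨x, hx, rfl⟩
    exact congrArg Subtype.val hx
  have hloc : IsLocalHomeomorph f := by
    have h1 : IsLocalHomeomorphOn p.eval W := fun x hx =>
      ⟨_, ((p.hasStrictDerivAt x).hasStrictFDerivAt_equiv (hd x hx)).mem_toOpenPartialHomeomorph_source, by simp⟩
    have hv : IsLocalHomeomorph (Subtype.val : Metric.ball (0:ℂ) η → ℂ) :=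
      (Metric.isOpen_ball.isOpenEmbedding_subtypeVal).isLocalHomeomorph
    have hw : IsLocalHomeomorph (Subtype.val : W → ℂ) :=
      (hWo.isOpenEmbedding_subtypeVal).isLocalHomeomorph
    rw [isLocalHomeomorph_iff_isLocalHomeomorphOn_univ] at hv hw ⊢
    refine IsLocalHomeomorphOn.of_comp_left (g := Subtype.val) ?_ (hv.mono (Set.subset_univ _)) (fun x _ => hfc.continuousAt)
    exact h1.comp hw (fun x _ => x.2)
  have hcov : IsCoveringMap f := by
    rw [isCoveringMap_iff_isCoveringMapOn_univ]
    refine IsClosedMap.isCoveringMapOn_of_isLocalHomeomorphOn hproper.isClosedMap (fun b _ => hfin b) ?_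
    rw [Set.preimage_univ, ← isLocalHomeomorph_iff_isLocalHomeomorphOn_univ]
    exact hloc
  have : ContractibleSpace (Metric.ball (0:ℂ) η) :=
    (convex_ball (0:ℂ) η).contractibleSpace ⟨0, by simpa using hη⟩
  have : LocallyPathConnectedSpace (Metric.ball (0:ℂ) η) := Metric.isOpen_ball.locallyPathConnectedSpace
  let z0 : Metric.ball (0:ℂ) η := ⟨0, by simpa using hη⟩
  let S := {F : C(Metric.ball (0:ℂ) η, W) // f ∘ F = id}
  have uniq : ∀ F G : S, ∀ z, F.1 z = G.1 z → F = G := by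
    intro F G z h
    have he : f (F.1 z) = (ContinuousMap.id _ : C(Metric.ball (0:ℂ) η, Metric.ball (0:ℂ) η)) z := congrFun F.2 z
    have := (hcov.existsUnique_continuousMap_lifts (ContinuousMap.id _) z (F.1 z) he)
    exact Subtype.ext (this.unique ⟨rfl, F.2⟩ ⟨h.symm, G.2⟩)
  have hSc : Countable S := by
    have : Finite (f ⁻¹' {z0}) := hfin z0
    have hinj : Function.Injective (fun F : S => (⟨F.1 z0, congrFun F.2 z0⟩ : f ⁻¹' {z0})) := by
      intro F G h
      exact uniq F G z0 (congrArg Subtype.val h)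
    exact hinj.countable
  have cover : ∀ x : W, ∃ F : S, F.1 (f x) = x := by
    intro x
    obtain ⟨F, ⟨h1, h2⟩, -⟩ := (hcov.existsUnique_continuousMap_lifts (ContinuousMap.id _) (f x) x rfl)
    exact ⟨⟨F, h2⟩, h1⟩
  classical
  let ψ : S → ℂ → ℂ := fun F z => if h : z ∈ Metric.ball (0:ℂ) η then (F.1 ⟨z, h⟩ : ℂ) else 0
  have hψ : ∀ F : S, ∀ z (h : z ∈ Metric.ball (0:ℂ) η), ψ F z = F.1 ⟨z, h⟩ := by
    intro F z h; simp only [ψ, dif_pos h]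
  have hψc : ∀ F : S, ContinuousOn (ψ F) (Metric.ball 0 η) := by
    intro F
    rw [continuousOn_iff_continuous_domRestrict]
    have : (Metric.ball (0:ℂ) η).domRestrict (ψ F) = fun z => (F.1 z : ℂ) := by
      ext z; exact hψ F z.1 z.2
    rw [this]
    exact continuous_subtype_val.comp F.1.continuous
  have hψp : ∀ F : S, ∀ z ∈ Metric.ball (0:ℂ) η, p.eval (ψ F z) = z := by
    intro F z hz
    rw [hψ F z hz]
    exact congrArg Subtype.val (congrFun F.2 ⟨z, hz⟩)
  have hψd : ∀ F : S, ∀ z ∈ Metric.ball (0:ℂ) η, p.derivative.eval (ψ F z) ≠ 0 := by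
    intro F z hz
    rw [hψ F z hz]
    exact hd _ (F.1 ⟨z, hz⟩).2
  have hWU : W = ⋃ F : S, ψ F '' Metric.ball 0 η := by
    ext x
    rw [Set.mem_iUnion]
    constructor
    · intro hx
      obtain ⟨F, hF⟩ := cover ⟨x, hx⟩
      refine ⟨F, (f ⟨x, hx⟩).1, (f ⟨x, hx⟩).2, ?_⟩
      rw [hψ F _ (f ⟨x, hx⟩).2]
      exact congrArg Subtype.val hF
    · rintro ⟨F, z, hz, rfl⟩
      rw [hψ F z hz]
      exact (F.1 ⟨z, hz⟩).2
  have hdisj : Pairwise (Function.onFun Disjoint fun F : S => ψ F '' Metric.ball 0 η) := by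
    intro F G hFG
    rw [Function.onFun, Set.disjoint_left]
    rintro _ ⟨z, hz, rfl⟩ ⟨y, hy, hyz⟩
    have e : y = z := by rw [← hψp G y hy, hyz, hψp F z hz]
    subst e
    rw [hψ F y hy, hψ G y hy] at hyz
    exact hFG (uniq F G ⟨y, hy⟩ (Subtype.ext hyz.symm))
  have hm : ∀ F : S, MeasurableSet (ψ F '' Metric.ball 0 η) := fun F => (section_weight hη (hψc F) (hψp F) (hψd F)).1
  rw [hWU, lintegral_iUnion hm hdisj, measure_iUnion hdisj hm, ← ENNReal.tsum_mul_left]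
  exact ENNReal.tsum_le_tsum fun F => (section_weight hη (hψc F) (hψp F) (hψd F)).2


def Sec (d : ℕ) : Set ℂ := {z : ℂ | z ≠ 0 ∧ (z ^ d) ^ ((d : ℂ)⁻¹) = z}

lemma Sec_meas (d : ℕ) : MeasurableSet (Sec d) := by
  refine (measurableSet_singleton (0:ℂ)).compl.inter (measurableSet_eq_fun ?_ measurable_id)
  fun_prop

lemma Sec_inj (d : ℕ) {a b : ℂ} (ha : a ∈ Sec d) (hb : b ∈ Sec d) (h : a ^ d = b ^ d) : a = b := by
  rw [← ha.2, ← hb.2, h]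

lemma sector_push {d : ℕ} (hd : 1 < d) (lam : ℂ) (r : ℝ) (hr : 0 ≤ r) (g : ℂ → ENNReal) :
    ∫⁻ x in Metric.ball lam (r ^ d), g x ≤
      ∫⁻ z in Sec d ∩ Metric.ball 0 r, ‖(d : ℂ) * z ^ (d - 1)‖ₑ ^ 2 * g (z ^ d + lam) := by
  have hd0 : d ≠ 0 := by omega
  rw [← cv (F := fun z => z ^ d + lam) ((Sec_meas d).inter Metric.isOpen_ball.measurableSet)
    (fun x _ => (hasDerivAt_pow d x).add_const lam)
    (fun a ha b hb h => Sec_inj d ha.1 hb.1 (by simpa using h))]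
  have hsub : Metric.ball lam (r ^ d) ⊆ {lam} ∪ (fun z => z ^ d + lam) '' (Sec d ∩ Metric.ball 0 r) := by
    intro x hx
    by_cases hxl : x = lam
    · left; exact hxl
    right
    have hne : x - lam ≠ 0 := sub_ne_zero.2 hxl
    have e : ((x - lam) ^ ((d : ℂ)⁻¹)) ^ d = x - lam := Complex.cpow_nat_inv_pow _ hd0
    refine ⟨(x - lam) ^ ((d : ℂ)⁻¹), ⟨⟨?_, by rw [e]⟩, ?_⟩, ?_⟩
    · intro h
      rw [h, zero_pow hd0] at e
      exact hne e.symm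
    · rw [mem_ball_zero_iff]
      refine lt_of_pow_lt_pow_left₀ d hr ?_
      rw [← norm_pow, e]
      simpa [dist_eq_norm] using hx
    · simp only [e]; ring
  refine (lintegral_mono_set hsub).trans ((lintegral_union_le _ _ _).trans ?_)
  simp

lemma sector_rot {d : ℕ} {ζ : ℂ} (hζ : IsPrimitiveRoot ζ d) (hd : 1 < d) {A : Set ℂ} (hA : MeasurableSet A)
    (hrot : ∀ z ∈ A, ∀ i : ℕ, ζ ^ i * z ∈ A) (g : ℂ → ENNReal) :
    ∑ i ∈ Finset.range d, ∫⁻ z in Sec d ∩ A, g (ζ ^ i * z) ≤ ∫⁻ z in A, g z := by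
  have hn : ‖ζ‖ = 1 := hζ.norm'_eq_one (by omega)
  have hζ0 : ζ ≠ 0 := by rintro rfl; simp at hn
  have hm : MeasurableSet (Sec d ∩ A) := (Sec_meas d).inter hA
  have hder : ∀ i : ℕ, ∀ x ∈ Sec d ∩ A, HasDerivAt (fun z => ζ ^ i * z) (ζ ^ i) x := by
    intro i x _
    simpa using (hasDerivAt_id x).const_mul (ζ ^ i)
  have hinj : ∀ i : ℕ, Set.InjOn (fun z => ζ ^ i * z) (Sec d ∩ A) := by
    intro i a _ b _ h
    exact mul_left_cancel₀ (pow_ne_zero i hζ0) h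
  have h1 : ∀ i : ℕ, ∫⁻ z in Sec d ∩ A, g (ζ ^ i * z) = ∫⁻ x in (fun z => ζ ^ i * z) '' (Sec d ∩ A), g x := by
    intro i
    rw [cv hm (hder i) (hinj i)]
    have : ‖ζ‖ₑ = 1 := by rw [← ofReal_norm, hn]; simp
    simp [enorm_pow, this]
  simp only [h1]
  rw [← lintegral_biUnion_finset]
  · refine lintegral_mono_set ?_
    simp only [Set.iUnion_subset_iff]
    rintro i _ _ ⟨z, hz, rfl⟩
    exact hrot z hz.2 i
  · intro i hi j hj hij
    rw [Function.onFun, Set.disjoint_left]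
    rintro _ ⟨a, ha, rfl⟩ ⟨b, hb, hab⟩
    simp only at hab
    have : a = b := by
      apply Sec_inj d ha.1 hb.1
      have := congrArg (· ^ d) hab
      simp only [mul_pow, ← pow_mul, mul_comm _ d] at this
      simpa [pow_mul, hζ.pow_eq_one] using this.symm
    subst this
    have h2 := mul_right_cancel₀ ha.1.1 hab
    exact hij (hζ.pow_inj (by simpa using hi) (by simpa using hj) h2.symm)
  · intro i _
    exact cv_meas hm (hder i) (hinj i)

lemma root_sum {d : ℕ} {ζ : ℂ} (hζ : IsPrimitiveRoot ζ d) (hd : 1 < d) {z a : ℂ} (h : z ^ d ≠ a ^ d) :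
    ∑ i ∈ Finset.range d, ζ ^ (2 * i) * (ζ ^ i * z - a)⁻¹ = d * (a * z ^ (d - 2) / (z ^ d - a ^ d)) := by
  have hne : z ^ d - a ^ d ≠ 0 := sub_ne_zero.2 h
  have h1 : ∀ i : ℕ, (ζ ^ i * z - a)⁻¹ = (∑ m ∈ Finset.range d, (ζ ^ i * z) ^ m * a ^ (d - 1 - m)) / (z ^ d - a ^ d) := by
    intro i
    have := (Commute.all (ζ ^ i * z) a).geom_sum₂_mul d
    rw [mul_pow, ← pow_mul, mul_comm i d, pow_mul, hζ.pow_eq_one, one_pow, one_mul] at this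
    have hne' : ζ ^ i * z - a ≠ 0 := by
      intro h0; rw [h0, mul_zero] at this; exact hne this.symm
    rw [eq_div_iff hne, ← this]
    field_simp
  simp only [h1]
  have h2 : ∀ m ∈ Finset.range d, ∑ i ∈ Finset.range d, ζ ^ (2 * i) * (ζ ^ i) ^ m = if m = d - 2 then (d:ℂ) else 0 := by
    intro m hm
    have hm' : m < d := by simpa using hm
    have e : ∀ i : ℕ, ζ ^ (2 * i) * (ζ ^ i) ^ m = (ζ ^ (m + 2)) ^ i := by intro i; ring
    simp only [e]
    split_ifs with hmd
    · have : m + 2 = d := by omega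
      simp [this, hζ.pow_eq_one]
    · have hne1 : ζ ^ (m + 2) ≠ 1 := by
        intro h0
        have := (hζ.pow_eq_one_iff_dvd _).1 h0
        obtain ⟨c, hc⟩ := this
        have : c ≠ 0 := by rintro rfl; omega
        have : c ≠ 1 := by rintro rfl; omega
        have h2c : 2 ≤ c := by omega
        have : d * 2 ≤ d * c := Nat.mul_le_mul_left d h2c
        have : d = m + 1 := by omega
        subst this
        have : c < 3 := by nlinarith
        have : c = 2 := by omega
        subst this; omega
      rw [geom_sum_eq hne1, ← pow_mul, mul_comm, pow_mul, hζ.pow_eq_one]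
      simp
  calc _ = (∑ m ∈ Finset.range d, (∑ i ∈ Finset.range d, ζ ^ (2 * i) * (ζ ^ i) ^ m) * (z ^ m * a ^ (d - 1 - m))) / (z ^ d - a ^ d) := by
        rw [Finset.sum_div]
        simp only [Finset.sum_mul, Finset.mul_sum, Finset.sum_div]
        rw [Finset.sum_comm]
        refine Finset.sum_congr rfl fun m _ => Finset.sum_congr rfl fun i _ => ?_
        rw [mul_pow]; ring
    _ = _ := by
        rw [Finset.sum_congr rfl fun m hm => by rw [h2 m hm]]
        simp only [ite_mul, zero_mul]
        rw [Finset.sum_ite_eq' (Finset.range d) (d-2), if_pos (by simp; omega)]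
        rw [show d - 1 - (d - 2) = 1 by omega]
        ring


/-- algebra of the transfer operator -/
lemma alg1 {d : ℕ} (hd : 1 < d) {N : ℕ} {lam : ℂ} {z β : ℕ → ℂ} (hz0 : z 0 = 0)
    (hz : ∀ k, z (k+1) = z k ^ d + lam) (hβ : ∀ k, 1 ≤ k → k ≤ N → β k = d * z k ^ (d-1) * β (k+1))
    (hsum : ∑ k ∈ Finset.range (N+1), β (k+1) = 0) {x : ℂ} (hx : x ≠ 0)
    (hg : ∀ k < N, x ^ d ≠ z (k+1) ^ d) :
    (d * x ^ (d-1)) ^ 2 * ∑ k ∈ Finset.range (N+1), β (k+1) * (x ^ d + lam - z (k+1))⁻¹ =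
      ∑ k ∈ Finset.range N, β (k+1) * (d * (z (k+1) * x ^ (d-2) / (x ^ d - z (k+1) ^ d))) := by
  obtain ⟨e, rfl⟩ : ∃ e, d = e + 2 := ⟨d - 2, by omega⟩
  simp only [show e + 2 - 1 = e + 1 by omega, Nat.add_sub_cancel] at *
  have h1 : ∀ k, x ^ (e+2) + lam - z (k+1) = x ^ (e+2) - z k ^ (e+2) := by intro k; rw [hz]; ring
  simp only [h1]
  have hterm : ∀ k ∈ Finset.range N, β (k+1) * (((e + 2 : ℕ):ℂ) * (z (k+1) * x ^ e / (x ^ (e+2) - z (k+1) ^ (e+2)))) =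
      (((e + 2 : ℕ):ℂ) * x ^ (e+1)) ^ 2 * (β (k+1+1) * (x ^ (e+2) - z (k+1) ^ (e+2))⁻¹) - ((e + 2 : ℕ):ℂ)^2 * x ^ e * β (k+1+1) := by
    intro k hk
    have hk' : k < N := by simpa using hk
    have hne : x ^ (e+2) - z (k+1) ^ (e+2) ≠ 0 := sub_ne_zero.2 (hg k hk')
    rw [hβ (k+1) (by omega) (by omega)]
    field_simp
    ring
  rw [Finset.sum_congr rfl hterm, Finset.sum_sub_distrib, ← Finset.mul_sum, ← Finset.mul_sum]
  rw [Finset.sum_range_succ'] at hsum ⊢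
  rw [hz0]
  have : ∑ k ∈ Finset.range N, β (k+1+1) = - β 1 := by linear_combination hsum
  rw [this]
  simp only [zero_add]
  rw [zero_pow (by omega), sub_zero]
  field_simp
  ring

lemma fin_inv (a : ℂ) (ρ : ℝ) : ∫⁻ z in Metric.ball (0:ℂ) ρ, ‖(z - a)⁻¹‖ₑ < ⊤ := by
  have h1 : ∫⁻ z in Metric.ball (0:ℂ) ρ, ‖(z - a)⁻¹‖ₑ = ∫⁻ z in Metric.ball (-a) ρ, ‖z⁻¹‖ₑ := by
    rw [← lintegral_indicator Metric.isOpen_ball.measurableSet,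
      ← lintegral_indicator Metric.isOpen_ball.measurableSet,
      ← lintegral_add_right_eq_self _ a]
    congr 1; ext z
    simp [Set.indicator, dist_eq_norm]
  rw [h1]
  have hsub : Metric.ball (-a) ρ ⊆ Metric.ball 0 (|ρ| + ‖a‖ + 1) := by
    apply Metric.ball_subset_ball'
    simp; linarith [le_abs_self ρ]
  refine (lintegral_mono_set hsub).trans_lt ?_
  have := int_inv_norm (ρ := |ρ| + ‖a‖ + 1) (by positivity)
  have e : ∀ z : ℂ, ‖z⁻¹‖ₑ = ENNReal.ofReal (‖z‖⁻¹) := by intro z; rw [← ofReal_norm, norm_inv]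
  simp only [e, this]
  exact ENNReal.ofReal_lt_top

lemma circ_H {N : ℕ} {z β : ℕ → ℂ} {r : ℝ} (hr : 0 < r) (h1 : ∀ k < N, r < ‖z (k+1)‖) (h2 : ‖z (N+1)‖ < r) (hb : β (N+1) = 1) :
    (∮ x in C(0, r), ∑ k ∈ Finset.range (N+1), β (k+1) * (x - z (k+1))⁻¹) = 2 * π * Complex.I := by
  have hne : ∀ k ∈ Finset.range (N+1), ‖z (k+1)‖ ≠ r := by
    intro k hk
    rcases Nat.lt_succ_iff_lt_or_eq.1 (Finset.mem_range.1 hk) with h | rfl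
    · exact (h1 k h).ne'
    · exact h2.ne
  have hci : ∀ k ∈ Finset.range (N+1), CircleIntegrable (fun x => β (k+1) * (x - z (k+1))⁻¹) 0 r := by
    intro k hk
    refine ContinuousOn.circleIntegrable hr.le ?_
    refine continuousOn_const.mul (ContinuousOn.inv₀ (by fun_prop) ?_)
    intro x hx h0
    rw [sub_eq_zero] at h0
    subst h0
    exact hne k hk (by simpa using hx)
  rw [circleIntegral.integral_fun_sum hci, Finset.sum_range_succ]
  simp only [circleIntegral.integral_const_mul]
  rw [hb, circleIntegral.integral_sub_inv_of_mem_ball (by simpa using h2), Finset.sum_eq_zero]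
  · simp
  intro k hk
  have hk' := h1 k (by simpa using hk)
  rw [DiffContOnCl.circleIntegral_eq_zero hr.le, mul_zero]
  refine DifferentiableOn.diffContOnCl_ball (U := Metric.closedBall 0 r) ?_ (subset_refl _)
  refine DifferentiableOn.inv (by fun_prop) ?_
  intro x hx h0
  rw [sub_eq_zero] at h0
  subst h0
  have : ‖z (k+1)‖ ≤ r := by simpa using hx
  linarith

lemma ann_int {s : ℝ} (hs : 0 < s) (hs2 : s < 2) :
    ∫⁻ z in {z : ℂ | ‖z‖ ∈ Set.Ico s 2}, ENNReal.ofReal ((‖z‖^2)⁻¹) = ENNReal.ofReal (2 * π * Real.log (2 / s)) := by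
  rw [radial_on (fun r => ENNReal.ofReal ((r^2)⁻¹)) (by fun_prop) measurableSet_Ico]
  rw [Set.inter_eq_left.2 (show Set.Ico s 2 ⊆ Set.Ioi 0 from fun x hx => lt_of_lt_of_le hs hx.1)]
  rw [ENNReal.ofReal_mul (p := 2*π) (by positivity)]
  congr 1
  have h : ∫⁻ r in Set.Ico s 2, ENNReal.ofReal r * ENNReal.ofReal ((r^2)⁻¹) = ∫⁻ r in Set.Ico s 2, ENNReal.ofReal (r⁻¹) := by
    refine setLIntegral_congr_fun measurableSet_Ico fun r hr => ?_
    have h0 : 0 < r := hs.trans_le hr.1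
    rw [← ENNReal.ofReal_mul h0.le]; congr 1; field_simp
  rw [h, ← ofReal_integral_eq_lintegral_ofReal]
  · rw [integral_Ico_eq_integral_Ioo, ← integral_Ioc_eq_integral_Ioo, ← intervalIntegral.integral_of_le hs2.le, integral_inv_of_pos hs (by norm_num)]
  · refine (ContinuousOn.integrableOn_Icc (a := s) (b := 2) ?_).mono_set Set.Ico_subset_Icc_self
    exact ContinuousOn.inv₀ continuousOn_id (fun x hx => (hs.trans_le hx.1).ne')
  · refine (ae_restrict_iff' measurableSet_Ico).2 (.of_forall fun r hr => ?_)
    exact inv_nonneg.2 (hs.le.trans hr.1)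


lemma bad_null {d : ℕ} (hd : 1 < d) (a : ℂ) : ∀ᵐ x : ℂ, x ^ d ≠ a := by
  have hf : {x : ℂ | x ^ d = a}.Finite := by
    have := Polynomial.finite_setOfPred_isRoot (p := (Polynomial.X ^ d - Polynomial.C a : Polynomial ℂ)) (Polynomial.X_pow_sub_C_ne_zero (by omega) a)
    refine this.subset ?_
    intro x hx
    simp only [Set.mem_ofPred_eq] at hx ⊢
    simp [Polynomial.IsRoot, hx]
  have := hf.measure_zero volume
  rw [ae_iff]
  simpa using this

lemma transv {d : ℕ} (hd : 1 < d) {N : ℕ} {lam : ℂ} (hlam : ‖lam‖ ≤ 2) {z β : ℕ → ℂ} (hz0 : z 0 = 0)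
    (hz : ∀ k, z (k+1) = z k ^ d + lam) (hβ : ∀ k, 1 ≤ k → k ≤ N → β k = d * z k ^ (d-1) * β (k+1))
    (hβN : β (N+1) = 1) {M : ℝ} (hM : ∀ k ≤ N, ‖β (k+1)‖ ≤ M) {s : ℝ} (hs : 0 < s) (hs2 : s < 2)
    (hzs : ∀ k < N, 2 * s ≤ ‖z (k+1)‖)
    (hw : ‖z (N+1)‖ * (1 + 4/3 * d * Real.log (2/s)) ≤ s/2)
    (hcs : (d:ℝ)^2 * N * M * s^(d-1) ≤ 1/4) :
    ∑ k ∈ Finset.range (N+1), β (k+1) ≠ 0 := by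
  intro hsum
  set w := z (N+1) with hwdef
  have hlog : 0 ≤ Real.log (2/s) := Real.log_nonneg (by rw [le_div_iff₀ hs]; linarith)
  have hM0 : 0 ≤ M := (norm_nonneg _).trans (hM 0 (by omega))
  have hws : ‖w‖ ≤ s/2 := by
    refine le_trans ?_ hw
    exact le_mul_of_one_le_right (norm_nonneg _) (by have : 0 ≤ 4/3 * d * Real.log (2/s) := by positivity
                                                     linarith)
  let H : ℂ → ℂ := fun x => ∑ k ∈ Finset.range (N+1), β (k+1) * (x - z (k+1))⁻¹
  let Pf : ℂ → ℂ := fun x => ∑ k ∈ Finset.range N, β (k+1) * (d * (z (k+1) * x ^ (d-2) / (x ^ d - z (k+1) ^ d)))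
  let J : ℂ → ℂ := fun x => d * (w * x ^ (d-2) / (x ^ d - w ^ d))
  have Hm : Measurable H := by fun_prop
  have Pm : Measurable Pf := by fun_prop
  have Jm : Measurable J := by fun_prop
  obtain ⟨ζ, hζ⟩ : ∃ ζ : ℂ, IsPrimitiveRoot ζ d := ⟨_, Complex.isPrimitiveRoot_exp d (by omega)⟩
  have hnζ : ‖ζ‖ = 1 := hζ.norm'_eq_one (by omega)
  have hgood : ∀ᵐ x : ℂ, x ≠ 0 ∧ ∀ k ∈ Finset.range (N+1), x ^ d ≠ z (k+1) ^ d := by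
    have h1 : ∀ᵐ x : ℂ, ∀ k ∈ Finset.range (N+1), x ^ d ≠ z (k+1) ^ d := by
      rw [Finset.eventually_all]
      exact fun k _ => bad_null hd _
    filter_upwards [h1, bad_null hd 0] with x hx h0
    refine ⟨?_, hx⟩
    rintro rfl; exact h0 (zero_pow (by omega))
  have hI : ∀ᵐ x : ℂ, ‖(d : ℂ) * x ^ (d - 1)‖ₑ ^ 2 * ‖H (x ^ d + lam)‖ₑ = ‖Pf x‖ₑ := by
    filter_upwards [hgood] with x hx
    rw [← enorm_pow, ← enorm_mul]
    congr 1
    exact alg1 hd hz0 hz hβ hsum hx.1 (fun k hk => hx.2 k (by simp; omega))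
  have hII : ∀ᵐ x : ℂ, Pf x = ∑ i ∈ Finset.range d, ζ ^ (2 * i) * H (ζ ^ i * x) - J x := by
    filter_upwards [hgood] with x hx
    have : ∑ i ∈ Finset.range d, ζ ^ (2 * i) * H (ζ ^ i * x) =
      ∑ k ∈ Finset.range (N+1), β (k+1) * ∑ i ∈ Finset.range d, ζ ^ (2 * i) * (ζ ^ i * x - z (k+1))⁻¹ := by
      simp only [H, Finset.mul_sum]
      rw [Finset.sum_comm]
      refine Finset.sum_congr rfl fun k _ => Finset.sum_congr rfl fun i _ => by ring
    rw [this, Finset.sum_congr rfl (fun k hk => by rw [root_sum hζ hd (hx.2 k hk)]), Finset.sum_range_succ]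
    simp only [Pf, J, hβN, one_mul, ← hwdef]
    ring
  have hIIn : ∀ᵐ x : ℂ, ‖Pf x‖ₑ ≤ ∑ i ∈ Finset.range d, ‖H (ζ ^ i * x)‖ₑ + ‖J x‖ₑ := by
    filter_upwards [hII] with x hx
    rw [hx]
    refine (enorm_sub_le).trans (add_le_add_left ((enorm_sum_le _ _).trans (le_of_eq ?_)) _)
    refine Finset.sum_congr rfl fun i _ => ?_
    have : ‖ζ‖ₑ = 1 := by rw [← ofReal_norm, hnζ]; simp
    simp [enorm_mul, enorm_pow, this]
  set A : Set ℂ := {x | ‖x‖ ∈ Set.Ico s 2} with hA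
  have hAm : MeasurableSet A := measurable_norm measurableSet_Ico
  have hAB : Metric.ball (0:ℂ) 2 = Metric.ball 0 s ∪ A := by
    ext x; simp only [hA, Set.mem_union, mem_ball_zero_iff, Set.mem_ofPred_eq, Set.mem_Ico]
    constructor
    · intro h; rcases lt_or_ge ‖x‖ s with h1 | h1
      · exact Or.inl h1
      · exact Or.inr ⟨h1, h⟩
    · rintro (h | h)
      · linarith
      · exact h.2
  have hdisj : Disjoint (Metric.ball (0:ℂ) s) A := by
    rw [Set.disjoint_left]; intro x hx hx'
    rw [mem_ball_zero_iff] at hx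
    exact absurd hx'.1 (not_le.2 hx)
  have hBm : MeasurableSet (Metric.ball (0:ℂ) s) := Metric.isOpen_ball.measurableSet
  have hfin : ∫⁻ x in A, ‖H x‖ₑ ≠ ⊤ := by
    refine ((lintegral_mono_set (t := Metric.ball (0:ℂ) 2) (by rw [hAB]; exact Set.subset_union_right)).trans_lt ?_).ne
    calc ∫⁻ x in Metric.ball (0:ℂ) 2, ‖H x‖ₑ ≤ ∫⁻ x in Metric.ball (0:ℂ) 2, ∑ k ∈ Finset.range (N+1), ‖β (k+1)‖ₑ * ‖(x - z (k+1))⁻¹‖ₑ := by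
          refine lintegral_mono fun x => (enorm_sum_le _ _).trans (le_of_eq ?_)
          simp only [enorm_mul]
      _ = ∑ k ∈ Finset.range (N+1), ‖β (k+1)‖ₑ * ∫⁻ x in Metric.ball (0:ℂ) 2, ‖(x - z (k+1))⁻¹‖ₑ := by
          rw [lintegral_finsetSum _ (fun k _ => by fun_prop)]
          refine Finset.sum_congr rfl fun k _ => ?_
          rw [lintegral_const_mul' _ _ (by simp)]
      _ < ⊤ := by
          refine ENNReal.sum_lt_top.2 fun k _ => ENNReal.mul_lt_top (by simp) (fin_inv _ _)
  have hsubB : Metric.ball (0:ℂ) 2 ⊆ Metric.ball lam (2 ^ d) := by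
    apply Metric.ball_subset_ball'
    have : (2:ℝ)^2 ≤ 2^d := pow_le_pow_right₀ (by norm_num) (by omega)
    rw [dist_eq_norm]; simp; linarith
  have main : (∫⁻ x in Metric.ball (0:ℂ) s, ‖H x‖ₑ) + (∫⁻ x in A, ‖H x‖ₑ) ≤
     ((∫⁻ x in Metric.ball (0:ℂ) s, ‖Pf x‖ₑ) + (∫⁻ x in A, ‖J x‖ₑ)) + (∫⁻ x in A, ‖H x‖ₑ) := by
    calc _ = (∫⁻ x in Metric.ball (0:ℂ) 2, ‖H x‖ₑ) := by
          rw [hAB, lintegral_union hAm hdisj]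
      _ ≤ (∫⁻ x in Metric.ball lam (2 ^ d), ‖H x‖ₑ) := lintegral_mono_set hsubB
      _ ≤ ∫⁻ x in Sec d ∩ Metric.ball 0 2, ‖(d : ℂ) * x ^ (d - 1)‖ₑ ^ 2 * ‖H (x ^ d + lam)‖ₑ :=
          sector_push hd lam 2 (by norm_num) _
      _ = (∫⁻ x in Sec d ∩ Metric.ball 0 2, ‖Pf x‖ₑ) := lintegral_congr_ae (ae_restrict_of_ae hI)
      _ ≤ (∫⁻ x in Metric.ball (0:ℂ) s, ‖Pf x‖ₑ) + (∫⁻ x in Sec d ∩ A, ‖Pf x‖ₑ) := by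
          rw [hAB, Set.inter_union_distrib_left]
          refine (lintegral_union_le _ _ _).trans (add_le_add_left (lintegral_mono_set Set.inter_subset_right) _)
      _ ≤ (∫⁻ x in Metric.ball (0:ℂ) s, ‖Pf x‖ₑ) + (∫⁻ x in Sec d ∩ A, (∑ i ∈ Finset.range d, ‖H (ζ ^ i * x)‖ₑ + ‖J x‖ₑ)) := by
          refine add_le_add le_rfl ?_
          exact lintegral_mono_ae (ae_restrict_of_ae hIIn)
      _ = (∫⁻ x in Metric.ball (0:ℂ) s, ‖Pf x‖ₑ) + (∑ i ∈ Finset.range d, (∫⁻ x in Sec d ∩ A, ‖H (ζ ^ i * x)‖ₑ) + (∫⁻ x in Sec d ∩ A, ‖J x‖ₑ)) := by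
          rw [lintegral_add_right _ (by fun_prop), lintegral_finsetSum _ (fun k _ => by fun_prop)]
      _ ≤ (∫⁻ x in Metric.ball (0:ℂ) s, ‖Pf x‖ₑ) + ((∫⁻ x in A, ‖H x‖ₑ) + (∫⁻ x in A, ‖J x‖ₑ)) := by
          refine add_le_add le_rfl (add_le_add ?_ ?_)
          · refine sector_rot hζ hd hAm ?_ (fun x => ‖H x‖ₑ)
            intro x hx i
            simpa [hA, hnζ] using hx
          · exact lintegral_mono_set Set.inter_subset_right
      _ = _ := by ring
  have main2 := ENNReal.le_of_add_le_add_right hfin main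
  have lower : ENNReal.ofReal (2 * π * (s - ‖w‖)) ≤ ∫⁻ x in Metric.ball (0:ℂ) s, ‖H x‖ₑ := by
    calc _ = ∫⁻ r in Set.Ioo ‖w‖ s, ENNReal.ofReal (2 * π) := by
          rw [setLIntegral_const, Real.volume_Ioo, ENNReal.ofReal_mul (p := 2*π) (by positivity)]
      _ = ∫⁻ r in Set.Ioo ‖w‖ s, ‖∮ x in C(0, r), H x‖ₑ := by
          refine setLIntegral_congr_fun measurableSet_Ioo fun r hr => ?_
          simp only [H]
          rw [circ_H ((norm_nonneg _).trans_lt hr.1) (fun k hk => by have := hzs k hk; have := hr.2; linarith) hr.1 hβN]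
          rw [← ofReal_norm]; simp [abs_of_pos pi_pos]
      _ ≤ _ := polar_lower H Hm (norm_nonneg _)
      _ ≤ _ := lintegral_mono_set (fun x hx => by simpa using hx.2)
  have upX : ∫⁻ x in Metric.ball (0:ℂ) s, ‖Pf x‖ₑ ≤ ENNReal.ofReal (π * s / 2) := by
    have hb : ∀ x ∈ Metric.ball (0:ℂ) s, ‖Pf x‖ₑ ≤ ENNReal.ofReal (N * (2 * d^2 * M * s^(d-2))) := by
      intro x hx
      rw [mem_ball_zero_iff] at hx
      rw [← ofReal_norm]
      apply ENNReal.ofReal_le_ofReal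
      refine (norm_sum_le _ _).trans ?_
      rw [← nsmul_eq_mul]
      conv_rhs => rw [← Finset.card_range N]
      refine Finset.sum_le_card_nsmul _ _ _ fun k hk => ?_
      have hk' : k < N := by simpa using hk
      have hzk := hzs k hk'
      set a := z (k+1)
      have ha0 : 0 < ‖a‖ := by linarith
      rw [hβ (k+1) (by omega) (by omega)]
      have hMk := hM (k+1) (by omega)
      have hden : ‖a‖^d / 2 ≤ ‖x ^ d - a ^ d‖ := by
        have h1 : ‖a‖^d - ‖x‖^d ≤ ‖x ^ d - a ^ d‖ := by
          rw [← norm_pow, ← norm_pow, norm_sub_rev]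
          exact norm_sub_norm_le _ _
        have h2 : ‖x‖^d ≤ (‖a‖/2)^d := pow_le_pow_left₀ (norm_nonneg _) (by linarith) _
        have h3 : (‖a‖/2)^d ≤ ‖a‖^d / 2 := by
          rw [div_pow]
          have : (2:ℝ)^1 ≤ 2^d := pow_le_pow_right₀ (by norm_num) (by omega)
          exact div_le_div_of_nonneg_left (by positivity) (by norm_num) (by simpa using this)
        linarith
      have hden0 : 0 < ‖a‖^d / 2 := by positivity
      simp only [norm_mul, norm_div, norm_pow, Complex.norm_natCast]
      calc (d:ℝ) * ‖a‖^(d-1) * ‖β (k+1+1)‖ * (d * (‖a‖ * ‖x‖^(d-2) / ‖x ^ d - a ^ d‖))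
          ≤ (d:ℝ) * ‖a‖^(d-1) * M * (d * (‖a‖ * s^(d-2) / (‖a‖^d / 2))) := by
            gcongr
        _ = 2 * d^2 * M * s^(d-2) := by
            obtain ⟨e, rfl⟩ : ∃ e, d = e + 1 := ⟨d - 1, by omega⟩
            simp only [Nat.add_sub_cancel]
            field_simp
            ring
    calc _ ≤ ∫⁻ x in Metric.ball (0:ℂ) s, ENNReal.ofReal (N * (2 * d^2 * M * s^(d-2))) := setLIntegral_mono' hBm hb
      _ = ENNReal.ofReal (N * (2 * d^2 * M * s^(d-2)) * (s^2 * π)) := by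
          rw [setLIntegral_const, Complex.volume_ball, ENNReal.ofReal_mul (p := N * (2 * d^2 * M * s^(d-2))) (by positivity), ENNReal.ofReal_mul (p := s^2) (by positivity), ENNReal.ofReal_pow hs.le]
          congr 2
          exact (ENNReal.ofReal_coe_nnreal (p := NNReal.pi)).symm
      _ ≤ _ := by
          apply ENNReal.ofReal_le_ofReal
          have e : s^(d-2) * s^2 = s^(d-1) * s := by rw [← pow_add, ← pow_succ]; congr 1; omega
          have : N * (2 * d^2 * M * s^(d-2)) * (s^2 * π) = ((d:ℝ)^2 * N * M * s^(d-1)) * (2 * s * π) := by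
            linear_combination (N * (2 * d^2 * M) * π) * e
          rw [this]
          have := mul_le_mul_of_nonneg_right hcs (show 0 ≤ 2 * s * π by positivity)
          linarith
  have upY : ∫⁻ x in A, ‖J x‖ₑ ≤ ENNReal.ofReal (d * (4/3 * ‖w‖) * (2 * π * Real.log (2/s))) := by
    rw [ENNReal.ofReal_mul (by positivity), ← ann_int hs hs2, ← lintegral_const_mul' _ _ ENNReal.ofReal_ne_top]
    refine setLIntegral_mono' hAm fun x hx => ?_
    rw [← ofReal_norm, ← ENNReal.ofReal_mul (by positivity)]
    apply ENNReal.ofReal_le_ofReal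
    have hxs : s ≤ ‖x‖ := hx.1
    have hx0 : 0 < ‖x‖ := by linarith
    have hden : 3/4 * ‖x‖^d ≤ ‖x ^ d - w ^ d‖ := by
      have h1 : ‖x‖^d - ‖w‖^d ≤ ‖x ^ d - w ^ d‖ := by
        rw [← norm_pow, ← norm_pow]
        exact norm_sub_norm_le _ _
      have h2 : ‖w‖^d ≤ (‖x‖/2)^d := pow_le_pow_left₀ (norm_nonneg _) (by linarith) _
      have h3 : (‖x‖/2)^d ≤ ‖x‖^d / 4 := by
        rw [div_pow]
        have : (2:ℝ)^2 ≤ 2^d := pow_le_pow_right₀ (by norm_num) (by omega)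
        exact div_le_div_of_nonneg_left (by positivity) (by norm_num) (by linarith)
      linarith
    simp only [J, norm_mul, norm_div, norm_pow, Complex.norm_natCast]
    calc (d:ℝ) * (‖w‖ * ‖x‖^(d-2) / ‖x ^ d - w ^ d‖) ≤ (d:ℝ) * (‖w‖ * ‖x‖^(d-2) / (3/4 * ‖x‖^d)) := by
          gcongr
      _ = _ := by
          obtain ⟨e, rfl⟩ : ∃ e, d = e + 2 := ⟨d - 2, by omega⟩
          simp only [Nat.add_sub_cancel]
          field_simp
          ring
  have fin := lower.trans (main2.trans (add_le_add upX upY))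
  rw [← ENNReal.ofReal_add (by positivity) (by positivity), ENNReal.ofReal_le_ofReal_iff (by positivity)] at fin
  have : 2 * π * (s - ‖w‖) ≤ 2 * π * (s/4 + d * (4/3 * ‖w‖) * Real.log (2/s)) := by linarith
  have := le_of_mul_le_mul_left this (by positivity)
  nlinarith



noncomputable def Fz (d : ℕ) (k : ℕ) (lam : ℂ) : ℂ := (fc d lam)^[k] 0

lemma Fz_zero (d : ℕ) (lam : ℂ) : Fz d 0 lam = 0 := rfl

lemma Fz_succ (d k : ℕ) (lam : ℂ) : Fz d (k+1) lam = Fz d k lam ^ d + lam := by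
  rw [Fz, Function.iterate_succ_apply']; rfl

lemma Fz_one {d : ℕ} (hd : 1 < d) (lam : ℂ) : Fz d 1 lam = lam := by
  rw [Fz_succ, Fz_zero, zero_pow (by omega), zero_add]

noncomputable def FP (d : ℕ) : ℕ → Polynomial ℂ
  | 0 => 0
  | k+1 => FP d k ^ d + Polynomial.X

lemma FP_eval (d k : ℕ) (lam : ℂ) : (FP d k).eval lam = Fz d k lam := by
  induction k with
  | zero => simp [FP, Fz_zero]
  | succ k ih => rw [Fz_succ, FP, ← ih]; simp

lemma Fz_cont (d k : ℕ) : Continuous (Fz d k) := by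
  have : Fz d k = fun lam => (FP d k).eval lam := by ext; rw [FP_eval]
  rw [this]; exact (FP d k).continuous

noncomputable def bet (d n : ℕ) (lam : ℂ) (k : ℕ) : ℂ := ∏ i ∈ Finset.Ico k n, ((d:ℂ) * Fz d i lam ^ (d-1))

lemma FP_der (d n : ℕ) (lam : ℂ) : (FP d n).derivative.eval lam = ∑ k ∈ Finset.range n, bet d n lam (k+1) := by
  induction n with
  | zero => simp [FP]
  | succ n ih =>
    rw [FP, Polynomial.derivative_add, Polynomial.derivative_X, Polynomial.derivative_pow, Finset.sum_range_succ]
    simp only [Polynomial.eval_add, Polynomial.eval_mul, Polynomial.eval_pow, ih, FP_eval, Polynomial.eval_one]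
    have h1 : bet d (n+1) lam (n+1) = 1 := by simp [bet]
    rw [h1, Finset.mul_sum]
    congr 1
    refine Finset.sum_congr rfl fun k hk => ?_
    have hk' : k < n := by simpa using hk
    simp only [bet]
    rw [Finset.prod_Ico_succ_top (by omega)]
    simp [mul_comm]

/-- escape -/
lemma esc_step {d : ℕ} (hd : 1 < d) {R : ℝ} (hR0 : 0 < R) (hR : R^(d-1) = 2) {lam z : ℂ} (h1 : R ≤ ‖z‖) (h2 : ‖lam‖ ≤ ‖z‖) :
    ‖z‖ ≤ ‖z ^ d + lam‖ ∧ ‖z‖^d / 2 ≤ ‖z ^ d + lam‖ ∧ ‖z ^ d + lam‖ ≤ 2 * ‖z‖^d := by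
  have ha : 2 ≤ ‖z‖^(d-1) := by rw [← hR]; exact pow_le_pow_left₀ hR0.le h1 _
  have hb : ‖z‖^d = ‖z‖^(d-1) * ‖z‖ := by rw [← pow_succ]; congr 1; omega
  have hc : 2 * ‖z‖ ≤ ‖z‖^d := by rw [hb]; exact mul_le_mul_of_nonneg_right ha (norm_nonneg _)
  have hl : ‖z‖^d - ‖lam‖ ≤ ‖z ^ d + lam‖ := by
    have := norm_sub_norm_le (z^d) (-lam)
    rwa [norm_pow, norm_neg, sub_neg_eq_add] at this
  have hu : ‖z ^ d + lam‖ ≤ ‖z‖^d + ‖lam‖ := by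
    rw [← norm_pow]; exact norm_add_le _ _
  refine ⟨by linarith, by linarith, by linarith [norm_nonneg z]⟩

lemma esc_mono {d : ℕ} (hd : 1 < d) {R : ℝ} (hR0 : 0 < R) (hR : R^(d-1) = 2) {lam : ℂ} {j : ℕ}
    (h1 : R ≤ ‖Fz d j lam‖) (h2 : ‖lam‖ ≤ ‖Fz d j lam‖) : ∀ m, ‖Fz d j lam‖ ≤ ‖Fz d (j+m) lam‖ := by
  intro m
  induction m with
  | zero => exact le_rfl
  | succ m ih =>
    rw [← add_assoc, Fz_succ]
    exact ih.trans (esc_step hd hR0 hR (h1.trans ih) (h2.trans ih)).1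

lemma lam_lt {d : ℕ} (hd : 1 < d) {R : ℝ} (hR0 : 0 < R) (hR : R^(d-1) = 2) {lam : ℂ} {n : ℕ} (hn : 1 ≤ n)
    (h : ‖Fz d n lam‖ < R) : ‖lam‖ < R := by
  by_contra! hc
  have := esc_mono hd hR0 hR (lam := lam) (j := 1) (by rwa [Fz_one hd]) (by rw [Fz_one hd]) (n-1)
  rw [Fz_one hd, show 1 + (n-1) = n by omega] at this
  linarith

lemma orb_lt {d : ℕ} (hd : 1 < d) {R : ℝ} (hR0 : 0 < R) (hR : R^(d-1) = 2) {lam : ℂ} {n : ℕ} (hn : 1 ≤ n)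
    (h : ‖Fz d n lam‖ < R) {i : ℕ} (hi : i ≤ n) : ‖Fz d i lam‖ < R := by
  by_contra! hc
  have := esc_mono hd hR0 hR (lam := lam) hc ((lam_lt hd hR0 hR hn h).le.trans hc) (n-i)
  rw [show i + (n-i) = n by omega] at this
  linarith

lemma pow_lip {d : ℕ} (hd : 1 < d) {R : ℝ} (hR0 : 0 < R) (hR : R^(d-1) = 2) {x y : ℂ} (hx : ‖x‖ ≤ R) (hy : ‖y‖ ≤ R) :
    ‖x^d - y^d‖ ≤ (2 * d) * ‖x - y‖ := by
  rw [← (Commute.all x y).geom_sum₂_mul d, norm_mul]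
  gcongr
  refine (norm_sum_le _ _).trans ?_
  have : (2 * (d:ℝ)) = (Finset.range d).card • (2:ℝ) := by simp [mul_comm]
  rw [this]
  refine Finset.sum_le_card_nsmul _ _ _ fun i hi => ?_
  have hi' : i < d := by simpa using hi
  rw [norm_mul, norm_pow, norm_pow]
  calc ‖x‖^i * ‖y‖^(d-1-i) ≤ R^i * R^(d-1-i) := by gcongr
    _ = 2 := by rw [← pow_add, ← hR]; congr 1; omega

lemma recur {d : ℕ} (hd : 1 < d) {R : ℝ} (hR0 : 0 < R) (hR : R^(d-1) = 2) {lam : ℂ} {n : ℕ} (hn : 1 ≤ n)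
    (h : ‖Fz d n lam‖ < R) {j : ℕ} (hj : 1 ≤ j) (hfirst : ∀ i, 1 ≤ i → i < j → ‖Fz d j lam‖ ≤ ‖Fz d i lam‖)
    (hsm : n * (2*d:ℝ)^n * ‖Fz d j lam‖^(d-1) ≤ 1/4) (hjn : j ≤ n) :
    3/4 * ‖Fz d j lam‖ ≤ ‖Fz d n lam‖ := by
  set D := (2*d:ℝ)^n * ‖Fz d j lam‖^d with hD
  have hd1 : (1:ℝ) ≤ 2*d := by
    have : (1:ℝ) ≤ d := by exact_mod_cast hd.le
    linarith
  have hD0 : 0 ≤ D := by positivity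
  have h1 : ∀ i, i + 1 + j ≤ n → ‖Fz d (i+1+j) lam - Fz d (i+1) lam‖ ≤ (2*d:ℝ)^i * ‖Fz d j lam‖^d := by
    intro i
    induction i with
    | zero =>
      intro _
      rw [zero_add, add_comm 1 j, Fz_succ, Fz_one hd]
      simp
    | succ i ih =>
      intro hi
      rw [show i + 1 + 1 + j = (i + 1 + j) + 1 by omega, Fz_succ, Fz_succ d (i+1), add_sub_add_right_eq_sub]
      refine (pow_lip hd hR0 hR (orb_lt hd hR0 hR hn h (by omega)).le (orb_lt hd hR0 hR hn h (by omega)).le).trans ?_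
      refine (mul_le_mul_of_nonneg_left (ih (by omega)) (by positivity)).trans (le_of_eq ?_)
      ring
  have h2 : ∀ m, 1 ≤ m → m + j ≤ n → ‖Fz d m lam‖ - D ≤ ‖Fz d (m+j) lam‖ := by
    intro m hm hmj
    obtain ⟨i, rfl⟩ : ∃ i, m = i + 1 := ⟨m-1, by omega⟩
    have ha := h1 i hmj
    have hb : (2*d:ℝ)^i * ‖Fz d j lam‖^d ≤ D := by
      rw [hD]; gcongr
      omega
    have hc := norm_sub_norm_le (Fz d (i+1) lam) (Fz d (i+1+j) lam)
    rw [norm_sub_rev] at hc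
    linarith
  have h3 : ∀ m, 1 ≤ m → m ≤ n → ‖Fz d j lam‖ - m * D ≤ ‖Fz d m lam‖ := by
    intro m
    induction m using Nat.strong_induction_on with
    | _ m ih =>
      intro hm hmn
      rcases lt_or_ge m j with hlt | hge
      · have := hfirst m hm hlt
        have : 0 ≤ m * D := by positivity
        linarith
      rcases eq_or_lt_of_le hge with rfl | hgt
      · have : 0 ≤ j * D := by positivity
        linarith
      have ha := ih (m-j) (by omega) (by omega) (by omega)
      have hb := h2 (m-j) (by omega) (by omega)
      rw [show m - j + j = m by omega] at hb
      have hc : ((m-j:ℕ):ℝ) ≤ m - 1 := by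
        rw [Nat.cast_sub hge]
        have : (1:ℝ) ≤ j := by exact_mod_cast hj
        linarith
      have := mul_le_mul_of_nonneg_right hc hD0
      linarith
  have h4 := h3 n hn le_rfl
  have h5 : n * D ≤ 1/4 * ‖Fz d j lam‖ := by
    have e : ‖Fz d j lam‖^d = ‖Fz d j lam‖^(d-1) * ‖Fz d j lam‖ := by rw [← pow_succ]; congr 1; omega
    rw [hD, e]
    have := mul_le_mul_of_nonneg_right hsm (norm_nonneg (Fz d j lam))
    linarith
  linarith

def Wj (d : ℕ) (s η : ℝ) (j : ℕ) : Set ℂ := {lam | ‖Fz d j lam‖ < η ∧ ∀ i, 1 ≤ i → i < j → 2 * s ≤ ‖Fz d i lam‖}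

lemma exists_W {d : ℕ} (hd : 1 < d) {R : ℝ} (hR1 : 1 < R) (hR : R^(d-1) = 2) {s η : ℝ} (hs : 0 < s) (hs1 : s ≤ 1) (hη : η ≤ s/2) (hη0 : 0 < η)
    {n : ℕ} (hn : 1 ≤ n) (hc : n * (2*d:ℝ)^n * (2*s)^(d-1) ≤ 1/4) {lam : ℂ} (h : ‖Fz d n lam‖ < 3/4 * η) :
    ∃ j, 1 ≤ j ∧ j ≤ n ∧ lam ∈ Wj d s η j ∧ 3/4 * ‖Fz d j lam‖ ≤ ‖Fz d n lam‖ := by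
  classical
  have hex : ∃ j, 1 ≤ j ∧ ‖Fz d j lam‖ < 2 * s := ⟨n, hn, by linarith⟩
  have hj := Nat.find_spec hex
  have hmin : ∀ i, 1 ≤ i → i < Nat.find hex → 2 * s ≤ ‖Fz d i lam‖ := by
    intro i h1 h2
    have := Nat.find_min hex h2
    push Not at this
    exact this h1
  have hle : Nat.find hex ≤ n := Nat.find_min' hex ⟨hn, by linarith⟩
  set j := Nat.find hex
  have hrec := recur hd (by linarith) hR hn (by linarith) hj.1 (fun i h1 h2 => hj.2.le.trans (hmin i h1 h2)) (le_trans (by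
    gcongr; exact hj.2.le) hc) hle
  exact ⟨j, hj.1, hle, ⟨by linarith, hmin⟩, hrec⟩

lemma W_alt {d : ℕ} (hd : 1 < d) {R : ℝ} (hR1 : 1 < R) (hR : R^(d-1) = 2) {s η : ℝ} (hs : 0 < s) (hs1 : s ≤ 1) (hη : η ≤ s/2)
    {n : ℕ} (hc : n * (2*d:ℝ)^n * (2*s)^(d-1) ≤ 1/4) {j : ℕ} (hj1 : 1 ≤ j) (hjn : j ≤ n) :
    Wj d s η j = {lam | ‖Fz d j lam‖ < η} ∩ ⋂ i ∈ Finset.Ico 1 j, {lam | s < ‖Fz d i lam‖} := by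
  classical
  ext lam
  simp only [Wj, Set.mem_ofPred_eq, Set.mem_inter_iff, Set.mem_iInter, Finset.mem_Ico]
  refine and_congr_right fun h => ⟨fun h1 i hi => by linarith [h1 i hi.1 hi.2], fun h1 => ?_⟩
  by_contra! hcon
  obtain ⟨i, hi1, hij, his⟩ := hcon
  have hex : ∃ j, 1 ≤ j ∧ ‖Fz d j lam‖ < 2 * s := ⟨i, hi1, his⟩
  have hk := Nat.find_spec hex
  have hmin : ∀ i, 1 ≤ i → i < Nat.find hex → 2 * s ≤ ‖Fz d i lam‖ := by
    intro i h1 h2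
    have := Nat.find_min hex h2
    push Not at this
    exact this h1
  have hle : Nat.find hex ≤ i := Nat.find_min' hex ⟨hi1, his⟩
  set k := Nat.find hex
  have hd1 : (1:ℝ) ≤ 2*d := by
    have : (1:ℝ) ≤ d := by exact_mod_cast hd.le
    linarith
  have hrec := recur hd (by linarith) hR hj1 (by linarith) hk.1 (fun i h1 h2 => hk.2.le.trans (hmin i h1 h2)) (le_trans (by
    gcongr
    exact hk.2.le) hc) (by omega)
  have := h1 k ⟨hk.1, by omega⟩
  linarith

lemma W_open {d : ℕ} (hd : 1 < d) {R : ℝ} (hR1 : 1 < R) (hR : R^(d-1) = 2) {s η : ℝ} (hs : 0 < s) (hs1 : s ≤ 1) (hη : η ≤ s/2)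
    {n : ℕ} (hc : n * (2*d:ℝ)^n * (2*s)^(d-1) ≤ 1/4) {j : ℕ} (hj1 : 1 ≤ j) (hjn : j ≤ n) : IsOpen (Wj d s η j) := by
  rw [W_alt hd hR1 hR hs hs1 hη hc hj1 hjn]
  refine (isOpen_lt (Fz_cont d j).norm continuous_const).inter (isOpen_biInter_finset fun i _ => ?_)
  exact isOpen_lt continuous_const (Fz_cont d i).norm

lemma W_sub {d : ℕ} (hd : 1 < d) {R : ℝ} (hR1 : 1 < R) (hR : R^(d-1) = 2) {s η : ℝ} (hs1 : s ≤ 1) (hη : η ≤ s/2)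
    {j : ℕ} (hj1 : 1 ≤ j) : Wj d s η j ⊆ Metric.ball 0 R := by
  intro lam h
  rw [mem_ball_zero_iff]
  exact lam_lt hd (by linarith) hR hj1 (by linarith [h.1])

lemma W_int {d : ℕ} (hd : 1 < d) {R : ℝ} (hR1 : 1 < R) (hR2 : R ≤ 2) (hR : R^(d-1) = 2) {s η : ℝ} (hs : 0 < s) (hs1 : s ≤ 1)
    (hη0 : 0 < η) (hη : η * (1 + 4/3 * d * Real.log (2/s)) ≤ s/2)
    {n : ℕ} (hc : n * (2*d:ℝ)^n * (2*s)^(d-1) ≤ 1/4) (hc2 : (d:ℝ)^2 * n * (2*d:ℝ)^n * s^(d-1) ≤ 1/4)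
    {j : ℕ} (hj1 : 1 ≤ j) (hjn : j ≤ n) :
    ∫⁻ lam in Wj d s η j, ENNReal.ofReal (η / ‖Fz d j lam‖) ≤ 6 * volume (Wj d s η j) := by
  have hlog : 0 ≤ Real.log (2/s) := Real.log_nonneg (by rw [le_div_iff₀ hs]; linarith)
  have hK : 0 ≤ 4/3 * d * Real.log (2/s) := by positivity
  have hη' : η ≤ s/2 := le_trans (le_mul_of_one_le_right hη0.le (by linarith)) hη
  have hd1 : (1:ℝ) ≤ 2*d := by
    have : (1:ℝ) ≤ d := by exact_mod_cast hd.le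
    linarith
  have := covering_weight (p := FP d j) hη0 (V := Metric.closedBall 0 R ∩ ⋂ i ∈ Finset.Ico 1 j, {lam | 2 * s ≤ ‖Fz d i lam‖})
    (W := Wj d s η j) ?_ ?_ (W_open hd hR1 hR hs hs1 hη' hc hj1 hjn) ?_
  · simpa only [FP_eval] using this
  · refine (isCompact_closedBall 0 R).inter_right (isClosed_biInter fun i _ => ?_)
    exact isClosed_le continuous_const (Fz_cont d i).norm
  · ext lam
    simp only [FP_eval, Wj, Set.mem_ofPred_eq, Set.mem_inter_iff, Set.mem_iInter, Finset.mem_Ico]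
    constructor
    · intro h
      refine ⟨⟨?_, fun i hi => h.2 i hi.1 hi.2⟩, h.1⟩
      exact Metric.ball_subset_closedBall (W_sub hd hR1 hR hs1 hη' hj1 h)
    · intro h
      exact ⟨h.2, fun i h1 h2 => h.1.2 i ⟨h1, h2⟩⟩
  · intro lam h
    rw [FP_der]
    obtain ⟨N, rfl⟩ : ∃ N, j = N + 1 := ⟨j-1, by omega⟩
    have hlamR := W_sub hd hR1 hR hs1 hη' hj1 h
    rw [mem_ball_zero_iff] at hlamR
    refine transv hd (by linarith) (z := fun k => Fz d k lam) (β := bet d (N+1) lam) (M := (2*d:ℝ)^n) (Fz_zero d lam) (fun k => Fz_succ d k lam) ?_ (by simp [bet]) ?_ hs (by linarith) ?_ ?_ ?_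
    · intro k hk1 hkN
      simp only [bet]
      rw [Finset.prod_eq_prod_Ico_succ_bot (by omega)]
    · intro k hk
      simp only [bet, norm_prod]
      calc ∏ i ∈ Finset.Ico (k+1) (N+1), ‖(d:ℂ) * Fz d i lam ^ (d-1)‖ ≤ ∏ i ∈ Finset.Ico (k+1) (N+1), (2*d:ℝ) := by
            refine Finset.prod_le_prod (fun i _ => norm_nonneg _) fun i hi => ?_
            have hi' := Finset.mem_Ico.1 hi
            have hlt := orb_lt hd (by linarith) hR hj1 (by linarith [h.1]) (i := i) (by omega)
            rw [norm_mul, norm_pow, Complex.norm_natCast, mul_comm, ← hR]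
            gcongr
        _ = (2*d:ℝ)^(N-k) := by simp
        _ ≤ _ := pow_le_pow_right₀ hd1 (by omega)
    · intro k hk
      exact h.2 (k+1) (by omega) (by omega)
    · refine le_trans ?_ hη
      gcongr
      exact h.1.le
    · refine le_trans ?_ hc2
      gcongr
      omega


lemma G_lim {d : ℕ} (hd : 1 < d) {lam : ℂ} {g : ℝ}
    (hg : Filter.Tendsto (fun k : ℕ => (1 / 2) * Real.log (1 + ‖(fc d lam)^[k] 0‖ ^ 2) / (d : ℝ) ^ (k - 1))
      Filter.atTop (nhds g)) {n : ℕ} (hn : 1 ≤ n) :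
    Filter.Tendsto (fun k : ℕ => (1 / 2) * Real.log (1 + ‖Fz d (n+k) lam‖ ^ 2) / (d : ℝ) ^ k)
      Filter.atTop (nhds ((d:ℝ)^(n-1) * g)) := by
  have h1 := ((hg.comp (Filter.tendsto_add_atTop_nat n)).const_mul ((d:ℝ)^(n-1)))
  refine h1.congr fun k => ?_
  have hd0 : (d:ℝ) ≠ 0 := by have : d ≠ 0 := by omega
                             exact_mod_cast this
  simp only [Function.comp]
  rw [show k + n - 1 = (n-1) + k by omega, pow_add, Fz, add_comm n k]
  field_simp

lemma esc_log {d : ℕ} (hd : 1 < d) {R : ℝ} (hR1 : 1 < R) (hR : R^(d-1) = 2) {lam : ℂ} {n : ℕ}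
    (h1 : R ≤ ‖Fz d n lam‖) (h2 : ‖lam‖ ≤ ‖Fz d n lam‖) (k : ℕ) :
    |Real.log ‖Fz d (n+k) lam‖ - (d:ℝ)^k * Real.log ‖Fz d n lam‖| ≤ ((d:ℝ)^k - 1) * Real.log 2 := by
  have hd2 : (2:ℝ) ≤ d := by exact_mod_cast hd
  have hl2 : 0 < Real.log 2 := Real.log_pos (by norm_num)
  induction k with
  | zero => simp
  | succ k ih =>
    have hm := esc_mono hd (by linarith) hR h1 h2 k
    obtain ⟨_, ha, hb⟩ := esc_step hd (by linarith) hR (h1.trans hm) (h2.trans hm)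
    rw [← add_assoc, Fz_succ]
    set z := Fz d (n+k) lam
    have hz : 0 < ‖z‖ := by linarith
    have hzd : 0 < ‖z‖^d := by positivity
    have hA : Real.log (‖z‖^d/2) ≤ Real.log ‖z^d+lam‖ := Real.log_le_log (by positivity) ha
    have hB : Real.log ‖z^d+lam‖ ≤ Real.log (2*‖z‖^d) := Real.log_le_log (by linarith) hb
    rw [Real.log_div hzd.ne' (by norm_num), Real.log_pow] at hA
    rw [Real.log_mul (by norm_num) hzd.ne', Real.log_pow] at hB
    rw [abs_le] at ih ⊢
    rw [pow_succ]
    have i1 := mul_le_mul_of_nonneg_left ih.1 (show (0:ℝ) ≤ d by linarith)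
    have i2 := mul_le_mul_of_nonneg_left ih.2 (show (0:ℝ) ≤ d by linarith)
    have i3 : 2 * Real.log 2 ≤ d * Real.log 2 := mul_le_mul_of_nonneg_right hd2 hl2.le
    constructor <;> nlinarith

lemma u_bd {x : ℝ} (hx : 1 ≤ x) : Real.log x ≤ 1/2 * Real.log (1 + x^2) ∧ 1/2 * Real.log (1 + x^2) ≤ Real.log x + Real.log 2 := by
  have h1 : Real.log (x^2) ≤ Real.log (1+x^2) := Real.log_le_log (by positivity) (by linarith)
  have h2 : Real.log (1+x^2) ≤ Real.log ((2*x)^2) := Real.log_le_log (by positivity) (by nlinarith)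
  rw [Real.log_pow] at h1 h2
  rw [Real.log_mul (by norm_num) (by linarith)] at h2
  push_cast at h1 h2
  constructor <;> linarith

lemma esc_G {d : ℕ} (hd : 1 < d) {R : ℝ} (hR1 : 1 < R) (hR : R^(d-1) = 2) {lam : ℂ} {n : ℕ} {G : ℝ}
    (hG : Filter.Tendsto (fun k : ℕ => (1 / 2) * Real.log (1 + ‖Fz d (n+k) lam‖ ^ 2) / (d : ℝ) ^ k) Filter.atTop (nhds G))
    (h1 : R ≤ ‖Fz d n lam‖) (h2 : ‖lam‖ ≤ ‖Fz d n lam‖) : |Real.log ‖Fz d n lam‖ - G| ≤ Real.log 2 := by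
  have hl2 : 0 < Real.log 2 := Real.log_pos (by norm_num)
  have hd0 : (0:ℝ) < d := by have : 0 < d := by omega
                             exact_mod_cast this
  have key : ∀ k : ℕ, Real.log ‖Fz d n lam‖ - Real.log 2 ≤ (1 / 2) * Real.log (1 + ‖Fz d (n+k) lam‖ ^ 2) / (d : ℝ) ^ k ∧
      (1 / 2) * Real.log (1 + ‖Fz d (n+k) lam‖ ^ 2) / (d : ℝ) ^ k ≤ Real.log ‖Fz d n lam‖ + Real.log 2 := by
    intro k
    have hk : 0 < (d:ℝ)^k := by positivity
    have hm := esc_mono hd (by linarith) hR h1 h2 k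
    have hu := u_bd (x := ‖Fz d (n+k) lam‖) (by linarith)
    have he := abs_le.1 (esc_log hd hR1 hR h1 h2 k)
    rw [le_div_iff₀ hk, div_le_iff₀ hk]
    constructor <;> nlinarith
  have a := ge_of_tendsto' hG fun k => (key k).1
  have b := le_of_tendsto' hG fun k => (key k).2
  rw [abs_le]; constructor <;> linarith

lemma u_step {d : ℕ} (lam z : ℂ) (hl : ‖lam‖ ≤ 2) :
    1/2 * Real.log (1 + ‖z^d+lam‖^2) ≤ d * (1/2 * Real.log (1+‖z‖^2)) + 2 * Real.log 2 := by
  have h1 : ‖z^d+lam‖ ≤ ‖z‖^d + 2 := by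
    have := norm_add_le (z^d) lam
    rw [norm_pow] at this; linarith
  have h2 : (‖z‖^d)^2 ≤ (1+‖z‖^2)^d := by
    rw [← pow_mul, mul_comm, pow_mul]
    exact pow_le_pow_left₀ (by positivity) (by linarith) _
  have h3 : 1 ≤ (1+‖z‖^2)^d := one_le_pow₀ (by nlinarith [norm_nonneg z])
  have h4 : 1 + ‖z^d+lam‖^2 ≤ 2^4 * (1+‖z‖^2)^d := by
    have : ‖z^d+lam‖^2 ≤ (‖z‖^d + 2)^2 := pow_le_pow_left₀ (norm_nonneg _) h1 _
    nlinarith [sq_nonneg (‖z‖^d - 2)]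
  have h5 := Real.log_le_log (by positivity) h4
  rw [Real.log_mul (by norm_num) (by positivity), Real.log_pow, Real.log_pow] at h5
  push_cast at h5
  linarith

lemma bd_G {d : ℕ} (hd : 1 < d) {lam : ℂ} {n : ℕ} {G : ℝ}
    (hG : Filter.Tendsto (fun k : ℕ => (1 / 2) * Real.log (1 + ‖Fz d (n+k) lam‖ ^ 2) / (d : ℝ) ^ k) Filter.atTop (nhds G))
    (h1 : ‖Fz d n lam‖ ≤ 2) (h2 : ‖lam‖ ≤ 2) : 0 ≤ G ∧ G ≤ 4 * Real.log 2 := by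
  have hl2 : 0 < Real.log 2 := Real.log_pos (by norm_num)
  have hd2 : (2:ℝ) ≤ d := by exact_mod_cast hd
  have ind : ∀ k : ℕ, (1 / 2) * Real.log (1 + ‖Fz d (n+k) lam‖ ^ 2) ≤
      (d:ℝ)^k * ((1 / 2) * Real.log (1 + ‖Fz d n lam‖ ^ 2)) + ((d:ℝ)^k - 1) * (2 * Real.log 2) := by
    intro k
    induction k with
    | zero => simp
    | succ k ih =>
      rw [← add_assoc, Fz_succ]
      refine (u_step lam _ h2).trans ?_
      have := mul_le_mul_of_nonneg_left ih (show (0:ℝ) ≤ d by linarith)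
      have i3 : 2 * Real.log 2 ≤ d * Real.log 2 := mul_le_mul_of_nonneg_right hd2 hl2.le
      rw [pow_succ (d:ℝ) k]
      nlinarith
  have hu : (1 / 2) * Real.log (1 + ‖Fz d n lam‖ ^ 2) ≤ 2 * Real.log 2 := by
    have : Real.log (1 + ‖Fz d n lam‖ ^ 2) ≤ Real.log (2^4) :=
      Real.log_le_log (by positivity) (by nlinarith [norm_nonneg (Fz d n lam)])
    rw [Real.log_pow] at this; push_cast at this; linarith
  refine ⟨ge_of_tendsto' hG fun k => ?_, le_of_tendsto' hG fun k => ?_⟩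
  · have : 0 ≤ Real.log (1 + ‖Fz d (n+k) lam‖ ^ 2) := Real.log_nonneg (by nlinarith [norm_nonneg (Fz d (n+k) lam)])
    positivity
  · have hk : 0 < (d:ℝ)^k := by positivity
    rw [div_le_iff₀ hk]
    have := mul_le_mul_of_nonneg_left hu hk.le
    linarith [ind k]

/-- global pointwise bound -/
lemma ptwise {d : ℕ} (hd : 1 < d) {R : ℝ} (hR1 : 1 < R) (hR2 : R ≤ 2) (hR : R^(d-1) = 2) {lam : ℂ} {g : ℝ}
    (hg : Filter.Tendsto (fun k : ℕ => (1 / 2) * Real.log (1 + ‖(fc d lam)^[k] 0‖ ^ 2) / (d : ℝ) ^ (k - 1))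
      Filter.atTop (nhds g)) {n : ℕ} (hn : 1 ≤ n) :
    |Real.log ‖Fz d n lam‖ - (d:ℝ)^(n-1) * g| ≤ 4 * Real.log 2 +
      (Metric.ball (0:ℂ) R).indicator (fun lam => max 0 (- Real.log ‖Fz d n lam‖)) lam := by
  have hG := G_lim hd hg hn
  have hl2 : 0 < Real.log 2 := Real.log_pos (by norm_num)
  have hi : 0 ≤ (Metric.ball (0:ℂ) R).indicator (fun lam => max 0 (- Real.log ‖Fz d n lam‖)) lam :=
    Set.indicator_nonneg (fun x _ => le_max_left _ _) _
  by_cases hz : R ≤ ‖Fz d n lam‖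
  · by_cases hl : ‖lam‖ < R
    · have := esc_G hd hR1 hR hG hz (by linarith)
      linarith
    · push Not at hl
      have h2 := esc_mono hd (by linarith) hR (lam := lam) (j := 1) (by rwa [Fz_one hd]) (by rw [Fz_one hd]) (n-1)
      rw [Fz_one hd, show 1 + (n-1) = n by omega] at h2
      have := esc_G hd hR1 hR hG hz h2
      linarith
  · push Not at hz
    have hl := lam_lt hd (by linarith) hR hn hz
    rw [Set.indicator_of_mem (by simpa using hl)]
    obtain ⟨h0, h4⟩ := bd_G hd hG (by linarith) (by linarith)
    have hlog : Real.log ‖Fz d n lam‖ ≤ Real.log 2 := by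
      rcases eq_or_lt_of_le (norm_nonneg (Fz d n lam)) with h | h
      · rw [← h]; simp [hl2.le]
      · exact Real.log_le_log h (by linarith)
    have m1 := le_max_left 0 (- Real.log ‖Fz d n lam‖)
    have m2 := le_max_right 0 (- Real.log ‖Fz d n lam‖)
    rw [abs_le]; constructor <;> linarith


lemma FP_ne {d : ℕ} (hd : 1 < d) {R : ℝ} (hR1 : 1 < R) (hR : R^(d-1) = 2) {j : ℕ} (hj : 1 ≤ j) : FP d j ≠ 0 := by
  intro h
  have hn : ‖(R:ℂ)‖ = R := by rw [Complex.norm_real, Real.norm_of_nonneg (by linarith)]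
  have h2 := esc_mono hd (by linarith) hR (lam := (R:ℂ)) (j := 1) (by rw [Fz_one hd, hn]) (by rw [Fz_one hd]) (j-1)
  rw [Fz_one hd, show 1 + (j-1) = j by omega, hn, ← FP_eval, h] at h2
  simp at h2
  linarith

lemma Fz_ne_ae {d : ℕ} (hd : 1 < d) {R : ℝ} (hR1 : 1 < R) (hR : R^(d-1) = 2) {j : ℕ} (hj : 1 ≤ j) :
    ∀ᵐ lam : ℂ, Fz d j lam ≠ 0 := by
  have hf : Set.Finite {lam : ℂ | ¬ (Fz d j lam ≠ 0)} := by
    refine ((FP d j).roots.toFinset.finite_toSet).subset fun lam h => ?_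
    simp only [Set.mem_ofPred_eq, not_not] at h
    simp [FP_ne hd hR1 hR hj, FP_eval, h]
  exact hf.measure_zero _

lemma neglog {d : ℕ} (hd : 1 < d) {R : ℝ} (hR1 : 1 < R) (hR : R^(d-1) = 2) {s η : ℝ} (hs : 0 < s) (hs1 : s ≤ 1) (hη : η ≤ s/2) (hη0 : 0 < η)
    {n : ℕ} (hn : 1 ≤ n) (hc : n * (2*d:ℝ)^n * (2*s)^(d-1) ≤ 1/4) {lam : ℂ} (h0 : ∀ j ∈ Finset.Icc 1 n, Fz d j lam ≠ 0) :
    max 0 (- Real.log ‖Fz d n lam‖) ≤ Real.log (4 * n / (3 * η)) +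
      (1/n:ℝ) * ∑ j ∈ Finset.Icc 1 n, (Wj d s η j).indicator (fun lam => η / ‖Fz d j lam‖) lam := by
  have hn0 : (1:ℝ) ≤ n := by exact_mod_cast hn
  have hind : ∀ j ∈ Finset.Icc 1 n, 0 ≤ (Wj d s η j).indicator (fun lam => η / ‖Fz d j lam‖) lam := by
    intro j _
    exact Set.indicator_nonneg (fun x _ => by positivity) _
  have hsum : 0 ≤ (1/n:ℝ) * ∑ j ∈ Finset.Icc 1 n, (Wj d s η j).indicator (fun lam => η / ‖Fz d j lam‖) lam :=
    mul_nonneg (by positivity) (Finset.sum_nonneg hind)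
  have hL : 0 ≤ Real.log (4 * n / (3 * η)) := Real.log_nonneg (by
    rw [le_div_iff₀ (by positivity)]; linarith)
  refine max_le (by positivity) ?_
  have hFn : 0 < ‖Fz d n lam‖ := norm_pos_iff.2 (h0 n (by simp [hn]))
  by_cases h : ‖Fz d n lam‖ < 3/4 * η
  · obtain ⟨j, hj1, hjn, hW, hj⟩ := exists_W hd hR1 hR hs hs1 hη hη0 hn hc h
    have hjm : j ∈ Finset.Icc 1 n := by simp [hj1, hjn]
    have hFj : 0 < ‖Fz d j lam‖ := norm_pos_iff.2 (h0 j hjm)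
    have h1 := Finset.single_le_sum hind hjm
    simp only [Set.indicator_of_mem hW] at h1
    have h2 : - Real.log ‖Fz d n lam‖ ≤ Real.log (4 * n / (3 * η)) + Real.log (1/n * (η / ‖Fz d j lam‖)) := by
      rw [← Real.log_inv, ← Real.log_mul (by positivity) (by positivity)]
      apply Real.log_le_log (by positivity)
      have : 4 * ↑n / (3 * η) * (1 / ↑n * (η / ‖Fz d j lam‖)) = (3/4 * ‖Fz d j lam‖)⁻¹ := by
        field_simp
      rw [this]
      exact inv_anti₀ (by positivity) hj
    have h3 : Real.log (1/n * (η / ‖Fz d j lam‖)) ≤ 1/n * (η / ‖Fz d j lam‖) := by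
      have := Real.log_le_sub_one_of_pos (x := 1/n * (η / ‖Fz d j lam‖)) (by positivity)
      linarith
    have h4 := mul_le_mul_of_nonneg_left h1 (show (0:ℝ) ≤ 1/n by positivity)
    linarith
  · push Not at h
    have : - Real.log ‖Fz d n lam‖ ≤ Real.log (4 * n / (3 * η)) := by
      rw [← Real.log_inv]
      apply Real.log_le_log (by positivity)
      rw [inv_le_iff_one_le_mul₀ hFn]
      calc (1:ℝ) ≤ n := hn0
        _ = 4 * n / (3*η) * (3/4*η) := by field_simp
        _ ≤ _ := by gcongr
    linarith

lemma w_int : Integrable (fun lam : ℂ => ((1 + ‖lam‖^2)^2)⁻¹) := by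
  have := integrable_rpow_neg_one_add_norm_sq (E := ℂ) (μ := volume) (r := 4) (by rw [Complex.finrank_real_complex]; norm_num)
  refine this.congr (Filter.Eventually.of_forall fun x => ?_)
  beta_reduce
  rw [show (-4/2:ℝ) = -((2:ℕ):ℝ) by norm_num, Real.rpow_neg (by positivity), Real.rpow_natCast]

lemma w_ball : ∫ lam in Metric.ball (0:ℂ) 2, ((1 + ‖lam‖^2)^2)⁻¹ ≤ 4/5 * π := by
  have hset : Metric.ball (0:ℂ) 2 = {z : ℂ | ‖z‖ ∈ Set.Iio (2:ℝ)} := by ext; simp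
  rw [integral_eq_lintegral_of_nonneg_ae (Filter.Eventually.of_forall fun x => by positivity) w_int.aestronglyMeasurable.restrict]
  apply ENNReal.toReal_le_of_le_ofReal (by positivity)
  rw [hset]
  have h := radial_on (f := fun r => ENNReal.ofReal (((1 + r^2)^2)⁻¹)) (by fun_prop) (t := Set.Iio (2:ℝ)) measurableSet_Iio
  rw [h]
  have hd : ∀ x ∈ Set.uIcc (0:ℝ) 2, HasDerivAt (fun r => -(1/2) * (1 + r^2)⁻¹) (x * ((1 + x^2)^2)⁻¹) x := by
    intro x _
    have hx : 1 + x^2 ≠ 0 := by positivity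
    have h1 : HasDerivAt (fun r : ℝ => 1 + r^2) (2*x) x := by simpa using (hasDerivAt_pow 2 x).const_add 1
    refine ((h1.fun_inv hx).const_mul (-(1/2))).congr_deriv ?_
    field_simp
  have hcont : Continuous (fun x : ℝ => x * ((1 + x^2)^2)⁻¹) := by
    refine continuous_id.mul (Continuous.inv₀ (by fun_prop) fun x => by positivity)
  have hI := intervalIntegral.integral_eq_sub_of_hasDerivAt hd (hcont.intervalIntegrable _ _)
  rw [intervalIntegral.integral_of_le (by norm_num), integral_Ioc_eq_integral_Ioo] at hI
  have e : Set.Iio (2:ℝ) ∩ Set.Ioi 0 = Set.Ioo 0 2 := by ext; simp [and_comm]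
  rw [e]
  have h2 : ∫⁻ r in Set.Ioo (0:ℝ) 2, ENNReal.ofReal r * ENNReal.ofReal (((1 + r^2)^2)⁻¹) = ENNReal.ofReal (2/5) := by
    have : (2/5:ℝ) = ∫ x in Set.Ioo (0:ℝ) 2, x * ((1 + x^2)^2)⁻¹ := by rw [hI]; norm_num
    rw [this, ofReal_integral_eq_lintegral_ofReal]
    · refine setLIntegral_congr_fun measurableSet_Ioo fun x hx => ?_
      rw [ENNReal.ofReal_mul hx.1.le]
    · exact (hcont.integrableOn_Icc (a := 0) (b := 2)).mono_set Set.Ioo_subset_Icc_self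
    · exact (ae_restrict_iff' measurableSet_Ioo).2 (Filter.Eventually.of_forall fun x hx => by
        have := hx.1; simp only [Pi.zero_apply]; positivity)
  rw [h2, ← ENNReal.ofReal_mul (by positivity)]
  apply ENNReal.ofReal_le_ofReal
  linarith


lemma W_term {d : ℕ} (hd : 1 < d) {R : ℝ} (hR1 : 1 < R) (hR2 : R ≤ 2) (hR : R^(d-1) = 2) {s η : ℝ} (hs : 0 < s) (hs1 : s ≤ 1)
    (hη0 : 0 < η) (hη1 : η ≤ s/2) (hη : η * (1 + 4/3 * d * Real.log (2/s)) ≤ s/2)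
    {n : ℕ} (hc : n * (2*d:ℝ)^n * (2*s)^(d-1) ≤ 1/4) (hc2 : (d:ℝ)^2 * n * (2*d:ℝ)^n * s^(d-1) ≤ 1/4)
    {j : ℕ} (hj1 : 1 ≤ j) (hjn : j ≤ n) :
    Integrable ((Wj d s η j).indicator (fun lam => η / ‖Fz d j lam‖)) ∧
    ∫ lam, (Wj d s η j).indicator (fun lam => η / ‖Fz d j lam‖) lam ≤ 24 * π := by
  have hm : MeasurableSet (Wj d s η j) := (W_open hd hR1 hR hs hs1 hη1 hc hj1 hjn).measurableSet
  have hmeas : Measurable (fun lam => η / ‖Fz d j lam‖) := measurable_const.div (Fz_cont d j).norm.measurable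
  have hb : ∫⁻ lam in Wj d s η j, ENNReal.ofReal (η / ‖Fz d j lam‖) ≤ ENNReal.ofReal (24 * π) := by
    refine (W_int hd hR1 hR2 hR hs hs1 hη0 hη hc hc2 hj1 hjn).trans ?_
    have h1 : volume (Wj d s η j) ≤ volume (Metric.ball (0:ℂ) 2) :=
      measure_mono ((W_sub hd hR1 hR hs1 hη1 hj1).trans (Metric.ball_subset_ball hR2))
    have h2 : volume (Metric.ball (0:ℂ) 2) = ENNReal.ofReal (4 * π) := by
      rw [Complex.volume_ball, ENNReal.ofReal_mul (by norm_num), ← ENNReal.ofReal_pow (by norm_num)]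
      congr 1
      · norm_num
      · rw [ENNReal.ofReal, Real.toNNReal_of_nonneg Real.pi_pos.le]; rfl
    rw [h2] at h1
    calc 6 * volume (Wj d s η j) ≤ ENNReal.ofReal 6 * ENNReal.ofReal (4*π) := by
          gcongr; simp
      _ = ENNReal.ofReal (24 * π) := by
          rw [← ENNReal.ofReal_mul (by norm_num)]; congr 1; ring
  have hnn : 0 ≤ᵐ[volume.restrict (Wj d s η j)] (fun lam => η / ‖Fz d j lam‖) :=
    Filter.Eventually.of_forall fun x => by simp only [Pi.zero_apply]; positivity
  constructor
  · rw [integrable_indicator_iff hm]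
    refine ⟨hmeas.aestronglyMeasurable, ?_⟩
    rw [hasFiniteIntegral_iff_ofReal hnn]
    exact hb.trans_lt ENNReal.ofReal_lt_top
  · rw [integral_indicator hm, integral_eq_lintegral_of_nonneg_ae hnn hmeas.aestronglyMeasurable]
    exact ENNReal.toReal_le_of_le_ofReal (by positivity) hb

lemma int_bound {d : ℕ} (hd : 1 < d) {gI : ℂ → ℝ}
    (hgI : ∀ lam : ℂ, Filter.Tendsto
      (fun k : ℕ => (1 / 2) * Real.log (1 + ‖(fc d lam)^[k] 0‖ ^ 2) / (d : ℝ) ^ (k - 1))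
      Filter.atTop (nhds (gI lam)))
    {R : ℝ} (hR1 : 1 < R) (hR2 : R ≤ 2) (hR : R^(d-1) = 2) {s η : ℝ} (hs : 0 < s) (hs1 : s ≤ 1)
    (hη0 : 0 < η) (hη1 : η ≤ s/2) (hη : η * (1 + 4/3 * d * Real.log (2/s)) ≤ s/2)
    {n : ℕ} (hn : 1 ≤ n) (hc : n * (2*d:ℝ)^n * (2*s)^(d-1) ≤ 1/4) (hc2 : (d:ℝ)^2 * n * (2*d:ℝ)^n * s^(d-1) ≤ 1/4) :
    (∫ lam : ℂ, |Real.log ‖(fc d lam)^[n] 0‖ - (d : ℝ) ^ (n - 1) * gI lam| / (1 + ‖lam‖ ^ 2) ^ 2) ≤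
      4 * Real.log 2 * (∫ lam : ℂ, ((1 + ‖lam‖^2)^2)⁻¹) + Real.log (4 * n / (3 * η)) * (4/5 * π) + 24 * π := by
  have hn0 : (1:ℝ) ≤ n := by exact_mod_cast hn
  set L := Real.log (4 * n / (3 * η)) with hLdef
  have hL : 0 ≤ L := Real.log_nonneg (by
    rw [le_div_iff₀ (by positivity)]; linarith)
  have hW := fun j (hj : j ∈ Finset.Icc 1 n) => W_term hd hR1 hR2 hR hs hs1 hη0 hη1 hη hc hc2 (Finset.mem_Icc.1 hj).1 (Finset.mem_Icc.1 hj).2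
  have i1 : Integrable (fun lam : ℂ => 4 * Real.log 2 * ((1 + ‖lam‖^2)^2)⁻¹) := w_int.const_mul _
  have i2 : Integrable (fun lam : ℂ => L * (Metric.ball (0:ℂ) 2).indicator (fun lam : ℂ => ((1 + ‖lam‖^2)^2)⁻¹) lam) :=
    (w_int.indicator Metric.isOpen_ball.measurableSet).const_mul _
  have i3 : Integrable (fun lam : ℂ => (1/n:ℝ) * ∑ j ∈ Finset.Icc 1 n, (Wj d s η j).indicator (fun lam => η / ‖Fz d j lam‖) lam) :=
    (integrable_finsetSum _ fun j hj => (hW j hj).1).const_mul _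
  have hae : ∀ᵐ lam : ℂ, ∀ j ∈ Finset.Icc 1 n, Fz d j lam ≠ 0 := by
    rw [Filter.eventually_all_finset]
    intro j hj
    exact Fz_ne_ae hd hR1 hR (Finset.mem_Icc.1 hj).1
  have hmain := integral_mono_of_nonneg (μ := volume)
    (f := fun lam : ℂ => |Real.log ‖(fc d lam)^[n] 0‖ - (d : ℝ) ^ (n - 1) * gI lam| / (1 + ‖lam‖ ^ 2) ^ 2)
    (Filter.Eventually.of_forall fun lam => by simp only [Pi.zero_apply]; positivity)
    ((i1.add i2).add i3) (by
      filter_upwards [hae] with lam h0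
      simp only [Pi.add_apply]
      have hp := ptwise hd hR1 hR2 hR (hgI lam) hn
      have hq := neglog hd hR1 hR hs hs1 hη1 hη0 hn hc h0
      set S := (1/n:ℝ) * ∑ j ∈ Finset.Icc 1 n, (Wj d s η j).indicator (fun lam => η / ‖Fz d j lam‖) lam
      have hS : 0 ≤ S := mul_nonneg (by positivity) (Finset.sum_nonneg fun j _ =>
        Set.indicator_nonneg (fun x _ => by positivity) _)
      have hw : 1 ≤ (1 + ‖lam‖^2)^2 := one_le_pow₀ (by nlinarith [norm_nonneg lam])
      have hw1 : ((1 + ‖lam‖^2)^2)⁻¹ ≤ 1 := inv_le_one_of_one_le₀ hw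
      have hw0 : 0 < ((1 + ‖lam‖^2)^2)⁻¹ := by positivity
      rw [Fz] at hp
      rw [div_eq_mul_inv]
      refine (mul_le_mul_of_nonneg_right hp hw0.le).trans ?_
      by_cases hb : lam ∈ Metric.ball (0:ℂ) R
      · rw [Set.indicator_of_mem hb, Set.indicator_of_mem (Metric.ball_subset_ball hR2 hb)]
        have := mul_le_mul_of_nonneg_right hq hw0.le
        nlinarith
      · rw [Set.indicator_of_notMem hb]
        have : 0 ≤ L * (Metric.ball (0:ℂ) 2).indicator (fun lam : ℂ => ((1 + ‖lam‖^2)^2)⁻¹) lam :=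
          mul_nonneg hL (Set.indicator_nonneg (fun x _ => by positivity) _)
        linarith)
  refine hmain.trans ?_
  simp only [Pi.add_apply]
  rw [integral_add (by exact i1.add i2) i3, integral_add i1 i2, integral_const_mul, integral_const_mul, integral_const_mul,
    integral_indicator Metric.isOpen_ball.measurableSet, integral_finsetSum _ (fun j hj => (hW j hj).1)]
  have a := mul_le_mul_of_nonneg_left w_ball hL
  have b : (1/n:ℝ) * ∑ j ∈ Finset.Icc 1 n, ∫ lam, (Wj d s η j).indicator (fun lam => η / ‖Fz d j lam‖) lam ≤ 24 * π := by
    have := Finset.sum_le_sum fun j hj => (hW j hj).2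
    rw [Finset.sum_const, Nat.card_Icc, nsmul_eq_mul] at this
    calc _ ≤ (1/n:ℝ) * (((n + 1 - 1 : ℕ):ℝ) * (24 * π)) := mul_le_mul_of_nonneg_left this (by positivity)
      _ = 24 * π := by rw [Nat.add_sub_cancel]; field_simp
  linarith

lemma log_le_lin {a y : ℝ} (ha : 0 < a) (hy : 0 < y) : Real.log y ≤ a * y - Real.log a := by
  have := Real.log_le_sub_one_of_pos (mul_pos ha hy)
  rw [Real.log_mul ha.ne' hy.ne'] at this
  linarith

lemma params {d : ℕ} (hd : 1 < d) : ∃ C : ℝ, ∀ n : ℕ, 1 ≤ n → ∃ s η : ℝ, 0 < s ∧ s ≤ 1 ∧ 0 < η ∧ η ≤ s/2 ∧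
    η * (1 + 4/3 * d * Real.log (2/s)) ≤ s/2 ∧ n * (2*d:ℝ)^n * (2*s)^(d-1) ≤ 1/4 ∧ (d:ℝ)^2 * n * (2*d:ℝ)^n * s^(d-1) ≤ 1/4 ∧
    4/5 * Real.log (4 * n / (3 * η)) ≤ (2 * Real.log d / ((d : ℝ) - 1)) * n + C := by
  have hd2 : (2:ℝ) ≤ d := by exact_mod_cast hd
  have hl2 : 0 < Real.log 2 := Real.log_pos (by norm_num)
  have hld : 0 < Real.log d := Real.log_pos (by linarith)
  set c : ℝ := 4 * 2^d * d^2 with hcdef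
  have h2d : (1:ℝ) ≤ 2^d := one_le_pow₀ (by norm_num)
  have hc1 : 1 ≤ c := by rw [hcdef]; nlinarith
  have hlc : 0 ≤ Real.log c := Real.log_nonneg hc1
  set κ := 2 * Real.log d / ((d : ℝ) - 1) with hκ
  have hd1 : (0:ℝ) < d - 1 := by linarith
  have hκ0 : 0 < κ := by positivity
  set a : ℝ := 1/8 / (2 * (4/3) * d) with ha
  have ha0 : 0 < a := by positivity
  refine ⟨4/5 * (Real.log (4/3) + a * (2 * (1 + 4/3 * d * Real.log 2)) - Real.log a + 9/8 * Real.log c) - 17/10 * Real.log (κ/17), fun n hn => ?_⟩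
  have hn0 : (1:ℝ) ≤ n := by exact_mod_cast hn
  have hln : 0 ≤ Real.log n := Real.log_nonneg hn0
  have hp1 : (1:ℝ) ≤ (2*d:ℝ)^n := one_le_pow₀ (by linarith)
  set K : ℝ := c * n * (2*d:ℝ)^n with hK
  have hK1 : 1 ≤ K := one_le_mul_of_one_le_of_one_le (one_le_mul_of_one_le_of_one_le hc1 hn0) hp1
  have hlK : Real.log K = Real.log c + Real.log n + n * Real.log (2*d) := by
    rw [hK, Real.log_mul (by positivity) (by positivity), Real.log_mul (by positivity) (by positivity), Real.log_pow]
  have hl2d : Real.log (2*d) ≤ 2 * Real.log d := by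
    rw [Real.log_mul (by norm_num) (by positivity)]
    linarith [Real.log_le_log (by norm_num) hd2]
  set x := Real.log K / (d-1) with hx
  have hx0 : 0 ≤ x := div_nonneg (Real.log_nonneg hK1) hd1.le
  have hxb : x ≤ κ * n + Real.log c + Real.log n := by
    have h1 : x ≤ (Real.log c + Real.log n + n * (2 * Real.log d)) / (d-1) := by
      rw [hx, hlK]; gcongr
    have h2 : (Real.log c + Real.log n) / ((d:ℝ)-1) ≤ Real.log c + Real.log n :=
      div_le_self (by positivity) (by linarith)
    rw [add_div] at h1
    have h3 : n * (2 * Real.log d) / ((d:ℝ)-1) = κ * n := by rw [hκ]; ring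
    linarith
  set s := Real.exp (-x) with hs
  have hs0 : 0 < s := Real.exp_pos _
  have hs1 : s ≤ 1 := Real.exp_le_one_iff.2 (by linarith)
  have hls : Real.log s = -x := Real.log_exp _
  have hsK : s^(d-1) = K⁻¹ := by
    rw [hs, ← Real.exp_nat_mul, Nat.cast_sub hd.le, Nat.cast_one, hx]
    rw [show ((d:ℝ)-1) * -(Real.log K / (d-1)) = - Real.log K by field_simp, Real.exp_neg, Real.exp_log (by linarith)]
  have hl2s : Real.log (2/s) = Real.log 2 + x := by
    rw [Real.log_div (by norm_num) hs0.ne', hls]; ring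
  set M := 1 + 4/3 * d * (Real.log 2 + x) with hM
  have hM1 : 1 ≤ M := by
    have : 0 ≤ 4/3 * d * (Real.log 2 + x) := by positivity
    linarith
  have hM0 : 0 < M := by linarith
  refine ⟨s, s / (2 * M), hs0, hs1, by positivity, ?_, ?_, ?_, ?_, ?_⟩
  · exact div_le_div_of_nonneg_left hs0.le (by norm_num) (by linarith)
  · rw [hl2s, ← hM]; apply le_of_eq; field_simp
  · rw [mul_pow 2 s, hsK, hK, hcdef]
    generalize (2*d:ℝ)^n = P at hp1
    have hP0 : 0 < P := by linarith
    have h3 : (2:ℝ)^d = 2^(d-1) * 2 := by rw [← pow_succ]; congr 1; omega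
    rw [h3]
    have h4 : (n:ℝ) * P * (2^(d-1) * (4 * (2^(d-1) * 2) * (d:ℝ)^2 * (n:ℝ) * P)⁻¹) = 1/4 * (1 / (2 * (d:ℝ)^2)) := by
      field_simp
    rw [h4]
    have : (1:ℝ) / (2 * (d:ℝ)^2) ≤ 1 := by
      rw [div_le_one (by positivity)]; nlinarith
    linarith
  · rw [hsK, hK, hcdef]
    generalize (2*d:ℝ)^n = P at hp1
    have hP0 : 0 < P := by linarith
    have h4 : (d:ℝ)^2 * (n:ℝ) * P * (4 * 2^d * (d:ℝ)^2 * (n:ℝ) * P)⁻¹ = 1/4 * (1 / 2^d) := by field_simp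
    rw [h4]
    have : (1:ℝ) / (2^d) ≤ 1 := by
      rw [div_le_one (by positivity)]; exact h2d
    linarith
  · have e : 4 * (n:ℝ) / (3 * (s / (2*M))) = 4/3 * n * (s⁻¹ * (2*M)) := by field_simp
    rw [e, Real.log_mul (by positivity) (by positivity), Real.log_mul (by positivity) (by positivity),
      Real.log_mul (by positivity) (by positivity), Real.log_inv, hls]
    have h1 := log_le_lin ha0 (show 0 < 2 * M by positivity)
    have h2 := log_le_lin (show 0 < κ/17 by positivity) (show (0:ℝ) < n by linarith)
    have h3 : a * (2 * M) = a * (2 * (1 + 4/3 * d * Real.log 2)) + 1/8 * x := by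
      rw [hM, ha]; field_simp; ring
    linarith

lemma exists_R {d : ℕ} (hd : 1 < d) : ∃ R : ℝ, 1 < R ∧ R ≤ 2 ∧ R^(d-1) = 2 := by
  have hd2 : (2:ℝ) ≤ d := by exact_mod_cast hd
  have hl2 : 0 < Real.log 2 := Real.log_pos (by norm_num)
  have hd1 : (0:ℝ) < d - 1 := by linarith
  refine ⟨Real.exp (Real.log 2 / (d-1)), ?_, ?_, ?_⟩
  · exact Real.one_lt_exp_iff.2 (by positivity)
  · calc _ ≤ Real.exp (Real.log 2) := Real.exp_le_exp.2 (div_le_self hl2.le (by linarith))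
      _ = 2 := Real.exp_log (by norm_num)
  · rw [← Real.exp_nat_mul, Nat.cast_sub hd.le, Nat.cast_one, mul_div_cancel₀ _ hd1.ne', Real.exp_log (by norm_num)]

theorem statement10 (d : ℕ) (hd : 1 < d) (gI : ℂ → ℝ)
    (hgI : ∀ lam : ℂ, Filter.Tendsto
      (fun k : ℕ => (1 / 2) * Real.log (1 + ‖(fc d lam)^[k] 0‖ ^ 2) / (d : ℝ) ^ (k - 1))
      Filter.atTop (nhds (gI lam))) :
    ∃ C : ℝ, 0 < C ∧ ∀ n : ℕ, 1 ≤ n →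
      π⁻¹ * (∫ lam : ℂ,
          |Real.log ‖(fc d lam)^[n] 0‖ - (d : ℝ) ^ (n - 1) * gI lam| / (1 + ‖lam‖ ^ 2) ^ 2)
        ≤ (2 * Real.log d / ((d : ℝ) - 1)) * n + C := by
  obtain ⟨R, hR1, hR2, hR⟩ := exists_R hd
  obtain ⟨C, hC⟩ := params hd
  set I0 := ∫ lam : ℂ, ((1 + ‖lam‖^2)^2)⁻¹ with hI0
  have hpos : 0 ≤ I0 := integral_nonneg fun x => by simp only [Pi.zero_apply]; positivity
  have hl2 : 0 < Real.log 2 := Real.log_pos (by norm_num)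
  have hpi := Real.pi_pos
  have hq : 0 ≤ π⁻¹ * (4 * Real.log 2 * I0) := by positivity
  refine ⟨|C| + π⁻¹ * (4 * Real.log 2 * I0) + 24, by linarith [abs_nonneg C], fun n hn => ?_⟩
  obtain ⟨s, η, hs, hs1, hη0, hη1, hη, hc, hc2, hL⟩ := hC n hn
  have h := mul_le_mul_of_nonneg_left (int_bound hd hgI hR1 hR2 hR hs hs1 hη0 hη1 hη hn hc hc2) (inv_nonneg.2 hpi.le)
  refine h.trans ?_
  rw [← hI0]
  have e : π⁻¹ * (4 * Real.log 2 * I0 + Real.log (4 * n / (3 * η)) * (4/5 * π) + 24 * π) =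
      π⁻¹ * (4 * Real.log 2 * I0) + 4/5 * Real.log (4 * n / (3 * η)) + 24 := by
    field_simp
  rw [e]
  linarith [le_abs_self C]
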